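/- arXiv:math/0102200 — 3 statements merged into one kernel-verified Lean document; each statement's English description precedes it below -/
import Mathlib

section
/- Fix c > 0 and p > 0. There is a constant K = K(c,p) such that for every integer n ≥ 2 and every weighted graph G with a vertex o and a vertex set z satisfying dist(o,z) ≥ n and w_z/w_o ≤ c n^p, the expected hitting time satisfies E[T_{oz}] > 2n²/((p+2) log n) − K n. -/
open MeasureTheory Filter
open scoped Classical ENNReal

namespace RWHitting

/-- A weighted graph on a vertex set `V`: a symmetric weight function with
positive finite vertex weights. -/
structure WeightedGraph (V : Type*) where
  w : V → V → ℝ≥0∞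
  symm : ∀ x y, w x y = w y x
  vw_pos : ∀ x, 0 < ∑' y, w x y
  vw_lt_top : ∀ x, ∑' y, w x y < ⊤

namespace WeightedGraph

variable {V : Type*}

/-- The weight of a vertex. -/
noncomputable def vw (G : WeightedGraph V) (x : V) : ℝ≥0∞ := ∑' y, G.w x y

/-- The weight of a vertex set. -/
noncomputable def setWeight (G : WeightedGraph V) (z : Set V) : ℝ≥0∞ := ∑' x : z, G.vw x

/-- `G.distGE o z m` : every path of positive-weight steps from `o` into `z` has length `≥ m`. -/
def distGE (G : WeightedGraph V) (o : V) (z : Set V) (m : ℕ) : Prop :=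
  ∀ (k : ℕ) (p : ℕ → V), p 0 = o → (∀ i, i < k → 0 < G.w (p i) (p (i+1))) → p k ∈ z → m ≤ k

/-- Transition probabilities of the random walk on `G`. -/
noncomputable def trans (G : WeightedGraph V) (x y : V) : ℝ≥0∞ := G.w x y / G.vw x

/-- Graph distance (as an extended nonneg real). -/
noncomputable def edist (G : WeightedGraph V) (x y : V) : ℝ≥0∞ :=
  ⨅ (k : ℕ) (_ : ∃ p : ℕ → V, p 0 = x ∧ p k = y ∧ ∀ i, i < k → 0 < G.w (p i) (p (i+1))),
    (k : ℝ≥0∞)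

/-- Total weight of the edges at distance `n` from `o` (each non-loop edge counted in both
orientations). -/
noncomputable def boundaryWeight (G : WeightedGraph V) (o : V) (n : ℕ) : ℝ≥0∞ :=
  ∑' q : V × V, if min (G.edist o q.1) (G.edist o q.2) = (n : ℝ≥0∞) then G.w q.1 q.2 else 0

end WeightedGraph

variable {V : Type*}

/-- `μ` is the law of the random walk on `G` started at `o`. -/
def IsRandomWalk [MeasurableSpace V] (G : WeightedGraph V) (o : V)
    (μ : Measure (ℕ → V)) : Prop :=
  IsProbabilityMeasure μ ∧
  ∀ (k : ℕ) (x : Fin (k+1) → V),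
    μ {ω | ∀ i : Fin (k+1), ω (i : ℕ) = x i}
      = (if x 0 = o then 1 else 0) * ∏ i : Fin k, G.trans (x i.castSucc) (x i.succ)

/-- First hitting time of the set `z` (`∞` if `z` is never visited). -/
noncomputable def hitTime (z : Set V) (ω : ℕ → V) : ℝ≥0∞ :=
  ⨅ (k : ℕ) (_ : ω k ∈ z), (k : ℝ≥0∞)

/-- Expected hitting time of `z`. -/
noncomputable def expHit [MeasurableSpace V] (μ : Measure (ℕ → V)) (z : Set V) : ℝ≥0∞ :=
  ∫⁻ ω, hitTime z ω ∂μ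

/-- Number of visits to `o` (counting time 0) strictly before hitting `z`. -/
noncomputable def visitsBefore (z : Set V) (o : V) (ω : ℕ → V) : ℝ≥0∞ :=
  ∑' k : ℕ, if ω k = o ∧ (k : ℝ≥0∞) < hitTime z ω then 1 else 0

/-- Effective resistance between `o` and `z`, defined probabilistically via the random walk
law `μ`:  `w_o r_{oz}` is the expected number of visits to `o` before hitting `z`. -/
noncomputable def resistance [MeasurableSpace V] (G : WeightedGraph V) (o : V) (z : Set V)
    (μ : Measure (ℕ → V)) : ℝ≥0∞ :=
  (∫⁻ ω, visitsBefore z o ω ∂μ) / G.vw o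

/-- One-step transition probabilities for the biased simple random walk on `ℤ`
with odds `1 : g` of going left/right. -/
noncomputable def biasedStep (g : ℝ) (a b : ℤ) : ℝ≥0∞ :=
  if b = a + 1 then ENNReal.ofReal (g / (g+1))
  else if b = a - 1 then ENNReal.ofReal (1 / (g+1)) else 0

/-- `ν` is the law of the biased simple random walk on `ℤ` started at `0`,
stepping right with probability `g/(g+1)` and left with probability `1/(g+1)`. -/
def IsBiasedWalk (g : ℝ) (ν : Measure (ℕ → ℤ)) : Prop :=
  IsProbabilityMeasure ν ∧
  ∀ (k : ℕ) (x : Fin (k+1) → ℤ),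
    ν {ω | ∀ i : Fin (k+1), ω (i : ℕ) = x i}
      = (if x 0 = 0 then 1 else 0) * ∏ i : Fin k, biasedStep g (x i.castSucc) (x i.succ)

/-- `e^{-λ t}` for an extended-real time `t`, with the convention `e^{-λ ∞} = 0`. -/
noncomputable def expNeg (lam : ℝ) (t : ℝ≥0∞) : ℝ≥0∞ :=
  if t = ⊤ then 0 else ENNReal.ofReal (Real.exp (-lam * t.toReal))

theorem two_mul_sub_div_add_le_log_sub_log {a b : ℝ} (hb : 0 < b) (hab : b ≤ a) :
    2 * (a - b) / (a + b) ≤ Real.log a - Real.log b := by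
  have ha : 0 < a := hb.trans_le hab
  have h := Real.le_log_one_add_of_nonneg (x := (a - b) / b)
    (div_nonneg (sub_nonneg.2 hab) hb.le)
  have e1 : 1 + (a - b) / b = a / b := by field_simp; ring
  have e2 : 2 * ((a - b) / b) / ((a - b) / b + 2) = 2 * (a - b) / (a + b) := by
    have : (a - b) / b + 2 = (a + b) / b := by field_simp; ring
    rw [this]
    field_simp
  rwa [e1, e2, Real.log_div ha.ne' hb.ne'] at h

theorem add_sub_abs_add_log_nonneg {a b : ℝ} (ha : 0 < a) (hb : 0 < b) (s : ℝ) :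
    0 ≤ a + b - 4 * s * |a - b| + 2 * s ^ 2 * ((a - b) * (Real.log a - Real.log b)) := by
  wlog hab : b ≤ a generalizing a b
  · have := this hb ha (le_of_not_ge hab)
    rw [abs_sub_comm]
    linarith
  have h := mul_le_mul_of_nonneg_left (two_mul_sub_div_add_le_log_sub_log hb hab)
    (sub_nonneg.2 hab)
  have h' := mul_le_mul_of_nonneg_left h (show 0 ≤ 2 * s ^ 2 by positivity)
  rw [abs_of_nonneg (sub_nonneg.2 hab)]
  have hab0 : 0 < a + b := by positivity
  have e : 0 ≤ (a + b - 2 * s * (a - b)) ^ 2 / (a + b) := by positivity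
  have e' : (a + b - 2 * s * (a - b)) ^ 2 / (a + b)
      = a + b - 4 * s * (a - b) + 2 * s ^ 2 * ((a - b) * (2 * (a - b) / (a + b))) := by
    field_simp; ring
  linarith

section Flow

variable {w : V → V → ℝ} {v : V → ℝ} {z : Set V} {o : V}

/-- Green's identity: testing the unit flow induced by the potential `v` against `f`. -/
theorem hasSum_flow_mul_sub (hw : ∀ x y, 0 ≤ w x y) (hv : ∀ x, 0 ≤ v x)
    (hsum : Summable fun q : V × V => w q.1 q.2 * v q.1)
    (hdiv : ∀ y ∉ z, ∑' x, w x y * v x = (∑' x, w y x * v y) - if y = o then 1 else 0)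
    {f : V → ℝ} {C : ℝ} (hf : ∀ x, |f x| ≤ C) (hfz : ∀ x ∈ z, f x = 0) :
    HasSum (fun q : V × V => w q.1 q.2 * v q.1 * (f q.1 - f q.2)) (f o) := by
  have bound : ∀ q : V × V, ∀ t : ℝ, |t| ≤ C → ‖w q.1 q.2 * v q.1 * t‖ ≤ C * (w q.1 q.2 * v q.1) := by
    intro q t ht
    have := mul_nonneg (hw q.1 q.2) (hv q.1)
    rw [norm_mul, Real.norm_of_nonneg this, mul_comm]
    exact mul_le_mul_of_nonneg_right ht this
  have h1 : Summable fun q : V × V => w q.1 q.2 * v q.1 * f q.1 :=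
    Summable.of_norm_bounded (hsum.mul_left C) fun q => bound q _ (hf _)
  have h2 : Summable fun q : V × V => w q.1 q.2 * v q.1 * f q.2 :=
    Summable.of_norm_bounded (hsum.mul_left C) fun q => bound q _ (hf _)
  have h2' : Summable fun q : V × V => w q.2 q.1 * v q.2 * f q.1 :=
    (Equiv.prodComm V V).summable_iff.2 h2
  have e2 : ∑' q : V × V, w q.1 q.2 * v q.1 * f q.2 = ∑' q : V × V, w q.2 q.1 * v q.2 * f q.1 :=
    ((Equiv.prodComm V V).tsum_eq fun q : V × V => w q.1 q.2 * v q.1 * f q.2).symm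
  have key : ∑' q : V × V, (w q.1 q.2 * v q.1 * f q.1 - w q.2 q.1 * v q.2 * f q.1) = f o := by
    have hs := h1.sub h2'
    rw [hs.tsum_prod' hs.prod_factor]
    have : ∀ x, ∑' y, (w x y * v x * f x - w y x * v y * f x) = if x = o then f o else 0 := by
      intro x
      rw [(h1.prod_factor x).tsum_sub (h2'.prod_factor x)]
      dsimp only
      rw [tsum_mul_right (f := fun y => w x y * v x), tsum_mul_right (f := fun y => w y x * v y),
        ← sub_mul]
      by_cases hx : x ∈ z
      · rw [hfz x hx, mul_zero]
        split_ifs with h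
        · rw [← h, hfz x hx]
        · rfl
      · rw [hdiv x hx]
        split_ifs with h
        · rw [h]; ring
        · ring
    simp only [this, tsum_ite_eq]
  have hs := h1.sub h2
  rw [h1.tsum_sub h2', ← e2, ← h1.tsum_sub h2] at key
  have := hs.hasSum
  rw [key] at this
  simpa only [mul_sub] using this

/-- The logarithm of `t` clamped to `[1 / N, N]`. -/
noncomputable def logClamp (N : ℕ) (t : ℝ) : ℝ := Real.log (max (1 / (N : ℝ)) (min t N))

theorem abs_logClamp_le {N : ℕ} (hN : 1 ≤ N) (t : ℝ) : |logClamp N t| ≤ Real.log N := by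
  have hN' : (1 : ℝ) ≤ N := by exact_mod_cast hN
  have h0 : (0 : ℝ) < 1 / N := by positivity
  have hle : 1 / (N : ℝ) ≤ N := ((div_le_one (by positivity)).2 hN').trans hN'
  rw [abs_le, logClamp]
  constructor
  · rw [← Real.log_inv, ← one_div]
    exact Real.log_le_log h0 (le_max_left _ _)
  · exact Real.log_le_log (h0.trans_le (le_max_left _ _)) (max_le hle (min_le_right _ _))

theorem monotone_logClamp {N : ℕ} (hN : 1 ≤ N) : Monotone (logClamp N) := by
  intro a b hab
  have h0 : (0 : ℝ) < 1 / N := by positivity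
  exact Real.log_le_log (h0.trans_le (le_max_left _ _))
    (max_le_max le_rfl (min_le_min hab le_rfl))

theorem eventually_logClamp_eq {t : ℝ} (ht : 0 < t) :
    ∀ᶠ N : ℕ in atTop, logClamp N t = Real.log t := by
  filter_upwards [eventually_ge_atTop ⌈t⌉₊, eventually_ge_atTop ⌈1 / t⌉₊] with N h1 h2
  have h1 : t ≤ N := Nat.ceil_le.1 h1
  have h2 : 1 / t ≤ N := Nat.ceil_le.1 h2
  rw [logClamp, min_eq_left h1, max_eq_right]
  rw [one_div_le (ht.trans_le h1) ht]
  exact h2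

theorem mul_neg_logClamp_le {N : ℕ} (hN : 1 ≤ N) {W a : ℝ} (hW : 0 < W) (ha : 0 ≤ a) :
    a * -logClamp N a ≤ a * (Real.log W - 1) + (1 + a / N) / W := by
  have hN' : (0 : ℝ) < N := by exact_mod_cast hN
  have hN1 : (1 : ℝ) ≤ N := by exact_mod_cast hN
  have hle : 1 / (N : ℝ) ≤ N := ((div_le_one (by positivity)).2 hN1).trans hN1
  set u := max (1 / (N : ℝ)) (min a N) with hu
  have u0 : 0 < u := lt_of_lt_of_le (by positivity) (le_max_left _ _)
  have h1 : -Real.log u ≤ Real.log W - 1 + 1 / (u * W) := by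
    have := Real.log_le_sub_one_of_pos (show 0 < 1 / (u * W) by positivity)
    rw [Real.log_div one_ne_zero (by positivity), Real.log_mul u0.ne' hW.ne', Real.log_one] at this
    linarith
  have h2 : a / u ≤ 1 + a / N := by
    rcases le_total a N with h | h
    · have : a / u ≤ 1 := (div_le_one u0).2 (by rw [hu, min_eq_left h]; exact le_max_right _ _)
      have : 0 ≤ a / N := by positivity
      linarith
    · have : u = N := by rw [hu, min_eq_right h, max_eq_right hle]
      rw [this]; linarith
  calc a * -logClamp N a ≤ a * (Real.log W - 1 + 1 / (u * W)) := mul_le_mul_of_nonneg_left h1 ha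
    _ = a * (Real.log W - 1) + a / u / W := by field_simp
    _ ≤ _ := by gcongr

/-- If the unit flow with potential `v` runs from `o` to `z`, the total weighted potential is
bounded below in terms of a Lipschitz function `g` that vanishes at and next to `z`. -/
theorem flow_lower_bound (hw : ∀ x y, 0 ≤ w x y) (hsymm : ∀ x y, w x y = w y x)
    (hv : ∀ x, 0 ≤ v x) (hvz : ∀ x ∈ z, v x = 0) (ho : o ∉ z)
    (hsum : Summable fun q : V × V => w q.1 q.2 * v q.1)
    (hdiv : ∀ y ∉ z, ∑' x, w x y * v x = (∑' x, w y x * v y) - if y = o then 1 else 0)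
    {W : ℝ} (hW : 0 < W) (hzs : Summable fun q : V × V => if q.2 ∈ z then w q.1 q.2 else 0)
    (hzW : ∑' q : V × V, (if q.2 ∈ z then w q.1 q.2 else 0) ≤ W)
    {g : V → ℝ} {C : ℝ} (hgC : ∀ x, |g x| ≤ C) (hgz : ∀ x ∈ z, g x = 0)
    (hgz' : ∀ x y, y ∈ z → 0 < w x y → g x = 0)
    (hg : ∀ x y, 0 < w x y → |g x - g y| ≤ 1) {s : ℝ} (hs : 0 ≤ s) :
    4 * s * (g o - 1) - 2 * s ^ 2 * (Real.log (v o) + Real.log W + 1)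
      ≤ ∑' q : V × V, w q.1 q.2 * v q.1 := by
  have hvpos : ∀ x y, y ∉ z → 0 < w x y → 0 < v x → 0 < v y := by
    intro x y hy hxy hx
    refine (hv y).lt_of_ne fun h0 => ?_
    have h1 := hdiv y hy
    have hsy : Summable fun x => w x y * v x := by
      have := ((Equiv.prodComm V V).summable_iff.2 hsum).prod_factor y
      exact this
    have h2 : w x y * v x ≤ ∑' x, w x y * v x :=
      hsy.le_tsum x fun i _ => mul_nonneg (hw _ _) (hv _)
    have h3 : 0 < w x y * v x := mul_pos hxy hx
    simp only [← h0, mul_zero, tsum_zero] at h1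
    split_ifs at h1 <;> linarith
  have hvo : 0 < v o := by
    refine (hv o).lt_of_ne fun h0 => ?_
    have h1 := hdiv o ho
    have h2 : 0 ≤ ∑' x, w x o * v x := tsum_nonneg fun i => mul_nonneg (hw _ _) (hv _)
    simp only [← h0, mul_zero, tsum_zero, if_true] at h1
    linarith
  set U : V × V → ℝ := fun q => w q.1 q.2 * v q.1 + w q.1 q.2 * v q.2 with hU
  have hsum' : Summable fun q : V × V => w q.1 q.2 * v q.2 := by
    have := (Equiv.prodComm V V).summable_iff.2 hsum
    refine this.congr fun q => ?_
    simp [hsymm q.2 q.1]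
  have hUs : Summable U := hsum.add hsum'
  have hU0 : ∀ q, 0 ≤ U q := fun q =>
    add_nonneg (mul_nonneg (hw _ _) (hv _)) (mul_nonneg (hw _ _) (hv _))
  obtain ⟨S, hS⟩ : ∃ S : Finset (V × V), ∑' q : {q // q ∉ S}, U q ≤ 2 :=
    ((tendsto_tsum_compl_atTop_zero U).eventually_le_const (by norm_num)).exists
  set χ : V × V → ℝ := fun q => if q.1 ∉ z ∧ q.2 ∉ z then 1 else 0 with hχ
  have hev : ∀ᶠ N : ℕ in atTop, ∀ q ∈ S, (0 < v q.1 → logClamp N (v q.1) = Real.log (v q.1)) ∧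
      (0 < v q.2 → logClamp N (v q.2) = Real.log (v q.2)) := by
    refine (Filter.eventually_all_finset S).2 fun q _ => ?_
    refine Filter.Eventually.and ?_ ?_
    · by_cases h : 0 < v q.1
      · filter_upwards [eventually_logClamp_eq h] with N hN _ using hN
      · exact Filter.Eventually.of_forall fun N h' => absurd h' h
    · by_cases h : 0 < v q.2
      · filter_upwards [eventually_logClamp_eq h] with N hN _ using hN
      · exact Filter.Eventually.of_forall fun N h' => absurd h' h
  obtain ⟨N, hNS, hNo, hN1, hNW⟩ := (hev.and ((eventually_logClamp_eq hvo).and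
    ((eventually_ge_atTop 1).and (eventually_ge_atTop ⌈1 / W⌉₊)))).exists
  have hN' : (0 : ℝ) < N := by exact_mod_cast hN1
  have hNW : 1 / W ≤ N := Nat.ceil_le.1 hNW
  set f : V → ℝ := fun x => if x ∈ z then 0 else logClamp N (v x) with hf
  have hfz : ∀ x ∈ z, f x = 0 := fun x hx => if_pos hx
  have hfn : ∀ x ∉ z, f x = logClamp N (v x) := fun x hx => if_neg hx
  have hfC : ∀ x, |f x| ≤ Real.log N := by
    intro x
    by_cases hx : x ∈ z
    · rw [hfz x hx, abs_zero]
      exact (abs_nonneg _).trans (abs_logClamp_le hN1 0)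
    · rw [hfn x hx]; exact abs_logClamp_le hN1 _
  have Df := hasSum_flow_mul_sub hw hv hsum hdiv hfC hfz
  have Dg := hasSum_flow_mul_sub hw hv hsum hdiv hgC hgz
  have D1 := hasSum_flow_mul_sub hw hv hsum hdiv (f := fun x => if x ∈ z then 0 else 1) (C := 1)
    (fun x => by split_ifs <;> simp) (fun x hx => if_pos hx)
  simp only [if_neg ho] at D1
  rw [hfn o ho, hNo] at Df
  -- the part of the flow along edges that avoid `z`
  set H : V × V → ℝ := fun q => χ q * (w q.1 q.2 * v q.1) *
    (1 + 2 * s ^ 2 * (f q.1 - f q.2) - 4 * s * (g q.1 - g q.2)) with hH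
  have hHle : ∀ q, H q ≤ w q.1 q.2 * v q.1
      + (2 * s ^ 2) * (w q.1 q.2 * v q.1 * (f q.1 - f q.2))
      - (4 * s) * (w q.1 q.2 * v q.1 * (g q.1 - g q.2))
      + (2 * s ^ 2) * ((Real.log W - 1 + 1 / (N * W)) * (w q.1 q.2 * v q.1 *
          ((if q.1 ∈ z then 0 else 1) - if q.2 ∈ z then 0 else 1))
        + 1 / W * if q.2 ∈ z then w q.1 q.2 else 0) := by
    rintro ⟨x, y⟩
    have hwv : 0 ≤ w x y * v x := mul_nonneg (hw _ _) (hv _)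
    simp only [hH, hχ]
    by_cases hx : x ∈ z
    · have : 0 ≤ if y ∈ z then w x y else 0 := by split_ifs; exacts [hw _ _, le_rfl]
      simp only [hx, hvz x hx, not_true, false_and, if_false, mul_zero, zero_mul, add_zero,
        sub_zero, zero_add]
      positivity
    · by_cases hy : y ∈ z
      · have hgx : w x y * v x * (g x - g y) = 0 := by
          rcases (hw x y).eq_or_lt with h | h
          · rw [← h]; ring
          · rw [hgz' x y hy h, hgz y hy]; ring
        have key := mul_neg_logClamp_le hN1 hW (hv x)
        have key' := mul_le_mul_of_nonneg_left key (mul_nonneg (sq_nonneg s) (hw x y))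
        simp only [hx, hy, hgx, hfz y hy, hfn x hx, not_true, and_false, if_false, if_true]
        have e : s ^ 2 * w x y * (v x * (Real.log W - 1) + (1 + v x / N) / W)
          = s ^ 2 * ((Real.log W - 1 + 1 / (N * W)) * (w x y * v x * (1 - 0))
            + 1 / W * w x y) := by field_simp; ring
        rw [e] at key'
        linarith
      · simp only [hx, hy, not_false_iff, and_self, if_true, if_false]
        linarith
  have hHge : ∀ q, -(4 * s) * (if q ∈ S then 0 else U q) ≤ H q + H q.swap := by
    rintro ⟨x, y⟩
    have hUxy := hU0 (x, y)
    simp only [hH, hχ, Prod.swap_prod_mk, hsymm y x]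
    by_cases hxy : x ∉ z ∧ y ∉ z
    swap
    · have hyx : ¬ (y ∉ z ∧ x ∉ z) := fun h => hxy h.symm
      simp only [hxy, hyx, if_false, zero_mul, add_zero]
      have : 0 ≤ if (x, y) ∈ S then 0 else U (x, y) := by split_ifs; exacts [le_rfl, hUxy]
      have := mul_nonneg hs this
      linarith
    obtain ⟨hx, hy⟩ := hxy
    simp only [hx, hy, not_false_iff, and_self, if_true, one_mul, hfn x hx, hfn y hy]
    have e : w x y * v x * (1 + 2 * s ^ 2 * (logClamp N (v x) - logClamp N (v y))
          - 4 * s * (g x - g y))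
        + w x y * v y * (1 + 2 * s ^ 2 * (logClamp N (v y) - logClamp N (v x))
          - 4 * s * (g y - g x))
        = w x y * (v x + v y - 4 * s * ((v x - v y) * (g x - g y))
          + 2 * s ^ 2 * ((v x - v y) * (logClamp N (v x) - logClamp N (v y)))) := by ring
    rw [e]
    rcases (hw x y).eq_or_lt with h0 | h0
    · have : U (x, y) = 0 := by simp [hU, ← h0]
      simp [this, ← h0]
    have hgg : (v x - v y) * (g x - g y) ≤ |v x - v y| := by
      refine (le_abs_self _).trans ?_
      rw [abs_mul]
      exact mul_le_of_le_one_right (abs_nonneg _) (hg x y h0)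
    have hsg := mul_le_mul_of_nonneg_left hgg hs
    split_ifs with hq
    · rw [mul_zero]
      refine mul_nonneg h0.le ?_
      rcases (hv x).eq_or_lt with hx0 | hx0
      · have : v y = 0 := by
          by_contra hne
          exact absurd (hvpos y x hx (by rwa [hsymm]) ((hv y).lt_of_ne' hne)) (by simp [← hx0])
        simp [← hx0, this]
      · have hy0 := hvpos x y hy h0 hx0
        have := add_sub_abs_add_log_nonneg hx0 hy0 s
        rw [(hNS _ hq).1 hx0, (hNS _ hq).2 hy0]
        linarith
    · have hmono : 0 ≤ (v x - v y) * (logClamp N (v x) - logClamp N (v y)) := by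
        rcases le_total (v x) (v y) with h | h
        · exact mul_nonneg_of_nonpos_of_nonpos (sub_nonpos.2 h)
            (sub_nonpos.2 (monotone_logClamp hN1 h))
        · exact mul_nonneg (sub_nonneg.2 h) (sub_nonneg.2 (monotone_logClamp hN1 h))
      have habs : |v x - v y| ≤ v x + v y := by
        rw [abs_le]; constructor <;> linarith [hv x, hv y]
      have hsa := mul_le_mul_of_nonneg_left habs hs
      have : -(4 * s) * U (x, y) = w x y * (-(4 * s) * (v x + v y)) := by simp only [hU]; ring
      rw [this]
      refine mul_le_mul_of_nonneg_left ?_ h0.le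
      have := mul_nonneg (sq_nonneg s) hmono
      linarith [hv x, hv y]
  have hHs : Summable H := by
    refine Summable.of_norm_bounded
      (g := fun q => (1 + 2 * s ^ 2 * (Real.log N + Real.log N) + 4 * s * (C + C)) *
        (w q.1 q.2 * v q.1)) (hsum.mul_left _) ?_
    rintro ⟨x, y⟩
    have hwv : 0 ≤ w x y * v x := mul_nonneg (hw _ _) (hv _)
    simp only [hH, norm_mul, Real.norm_eq_abs]
    have h1 : |χ (x, y)| ≤ 1 := by simp only [hχ]; split_ifs <;> simp
    have h2 : |f x - f y| ≤ Real.log N + Real.log N := (abs_sub _ _).trans (add_le_add (hfC x) (hfC y))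
    have h3 : |g x - g y| ≤ C + C := (abs_sub _ _).trans (add_le_add (hgC x) (hgC y))
    have h4 : |1 + 2 * s ^ 2 * (f x - f y) - 4 * s * (g x - g y)|
        ≤ 1 + 2 * s ^ 2 * (Real.log N + Real.log N) + 4 * s * (C + C) := by
      refine (abs_sub _ _).trans (add_le_add ((abs_add_le _ _).trans (add_le_add (by simp) ?_)) ?_)
      · rw [abs_mul, abs_of_nonneg (by positivity : 0 ≤ 2 * s ^ 2)]; gcongr
      · rw [abs_mul, abs_of_nonneg (by positivity : 0 ≤ 4 * s)]; gcongr
    rw [← abs_mul (w x y), abs_of_nonneg hwv, mul_comm]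
    refine mul_le_mul h4 ?_ (by positivity) ((abs_nonneg _).trans h4)
    exact mul_le_of_le_one_left hwv h1
  have hup := hasSum_le hHle hHs.hasSum (((hsum.hasSum.add (Df.mul_left (2 * s ^ 2))).sub
    (Dg.mul_left (4 * s))).add (((D1.mul_left (Real.log W - 1 + 1 / (N * W))).add
      (hzs.hasSum.mul_left (1 / W))).mul_left (2 * s ^ 2)))
  have hHsw : HasSum (fun q : V × V => H q.swap) (∑' q, H q) :=
    (Equiv.prodComm V V).hasSum_iff.2 hHs.hasSum
  have hind : (fun q => if q ∈ S then 0 else U q) = Set.indicator {q | q ∉ S} U := by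
    funext q
    by_cases hq : q ∈ S <;> simp [hq]
  have hUS : HasSum (fun q => if q ∈ S then 0 else U q) (∑' q : {q // q ∉ S}, U q) := by
    rw [hind]
    exact (hasSum_subtype_iff_indicator (s := {q | q ∉ S})).1
      ((hUs.subtype {q | q ∉ S}).hasSum)
  have hlow := hasSum_le hHge (hUS.mul_left (-(4 * s))) (hHs.hasSum.add hHsw)
  have h1 : -(4 * s) * 2 ≤ -(4 * s) * ∑' q : {q // q ∉ S}, U q :=
    mul_le_mul_of_nonpos_left hS (by linarith)
  have h2 : 1 / W * ∑' q : V × V, (if q.2 ∈ z then w q.1 q.2 else 0) ≤ 1 := by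
    rw [one_div, inv_mul_le_iff₀ hW, mul_one]; exact hzW
  have h3 : 1 / (N * W) ≤ 1 := by
    rw [div_le_one (by positivity)]
    rwa [div_le_iff₀ hW] at hNW
  have h4 := mul_le_mul_of_nonneg_left (add_le_add h2 h3) (by positivity : 0 ≤ 2 * s ^ 2)
  linarith

end Flow

theorem tsum_avoid_le_hitTime (z : Set V) (ω : ℕ → V) :
    ∑' k : ℕ, Set.indicator {ω : ℕ → V | ∀ j ≤ k, ω j ∉ z} 1 ω ≤ hitTime z ω := by
  refine le_iInf₂ fun k hk => ?_
  rw [tsum_eq_sum (s := Finset.range k)]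
  · calc ∑ i ∈ Finset.range k, Set.indicator {ω : ℕ → V | ∀ j ≤ i, ω j ∉ z} 1 ω
        ≤ ∑ _i ∈ Finset.range k, (1 : ℝ≥0∞) :=
        Finset.sum_le_sum fun i _ => Set.indicator_le_self' (by simp) _
      _ = k := by simp
  · intro j hj
    refine Set.indicator_of_notMem (fun h => ?_) _
    exact h k (by simpa using hj) hk

section Walk

variable [MeasurableSpace V] {G : WeightedGraph V} {o : V} {z : Set V} {μ : Measure (ℕ → V)}

/-- Probability that the walk is at `x` at time `k` and has not visited `z` up to time `k`. -/
noncomputable def survival (μ : Measure (ℕ → V)) (z : Set V) (k : ℕ) (x : V) : ℝ≥0∞ :=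
  μ {ω | (∀ j ≤ k, ω j ∉ z) ∧ ω k = x}

/-- Expected number of visits to `x` before hitting `z`. -/
noncomputable def green (μ : Measure (ℕ → V)) (z : Set V) (x : V) : ℝ≥0∞ :=
  ∑' k, survival μ z k x

theorem survival_eq_zero {x : V} (hx : x ∈ z) (k : ℕ) : survival μ z k x = 0 := by
  have : {ω : ℕ → V | (∀ j ≤ k, ω j ∉ z) ∧ ω k = x} = ∅ := by
    ext ω
    simp only [Set.mem_ofPred_eq, Set.mem_empty_iff_false, iff_false, not_and]
    exact fun h h' => h k le_rfl (h' ▸ hx)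
  rw [survival, this, measure_empty]

theorem green_eq_zero {x : V} (hx : x ∈ z) : green μ z x = 0 := by
  simp [green, survival_eq_zero hx]

theorem survival_zero (hμ : IsRandomWalk G o μ) {y : V} (hy : y ∉ z) :
    survival μ z 0 y = if y = o then 1 else 0 := by
  have h := hμ.2 0 fun _ => y
  simp only [Finset.univ_eq_empty, Finset.prod_empty, mul_one] at h
  rw [← h, survival]
  congr 1
  ext ω
  simp only [Set.mem_ofPred_eq, nonpos_iff_eq_zero, forall_eq]
  exact ⟨fun h i => by rw [Fin.val_eq_zero i, h.2], fun h => ⟨h 0 ▸ hy, h 0⟩⟩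

/-- Restriction of a trajectory to the times `0, …, k`. -/
def initialSegment (k : ℕ) (ω : ℕ → V) : Fin (k + 1) → V := fun i => ω i

theorem measurable_initialSegment (k : ℕ) : Measurable (initialSegment (V := V) k) :=
  measurable_pi_lambda _ fun i => measurable_pi_apply (i : ℕ)

variable [MeasurableSingletonClass V]

theorem measurableSet_eval_eq (k : ℕ) (x : V) : MeasurableSet {ω : ℕ → V | ω k = x} := by
  have : {ω : ℕ → V | ω k = x} = (fun ω : ℕ → V => ω k) ⁻¹' {x} := by
    ext ω; simp
  rw [this]
  exact measurable_pi_apply k (measurableSet_singleton x)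

variable [Countable V]

theorem measurableSet_avoid (z : Set V) (k : ℕ) :
    MeasurableSet {ω : ℕ → V | ∀ j ≤ k, ω j ∉ z} := by
  have : {ω : ℕ → V | ∀ j ≤ k, ω j ∉ z} = ⋂ j ≤ k, (fun ω : ℕ → V => ω j) ⁻¹' zᶜ := by
    ext ω; simp
  rw [this]
  exact MeasurableSet.iInter fun j => MeasurableSet.iInter fun _ =>
    measurable_pi_apply j (MeasurableSet.of_discrete)

theorem tsum_measure_inter_eval (μ : Measure (ℕ → V)) (k : ℕ) (E : Set (ℕ → V)) :
    ∑' x, μ ({ω | ω k = x} ∩ E) = μ E := by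
  have h := tsum_measure_preimage_singleton (μ := μ.restrict E) (s := (Set.univ : Set V))
    Set.countable_univ (f := fun ω : ℕ → V => ω k) fun y _ => measurableSet_eval_eq k y
  rw [Set.preimage_univ, Measure.restrict_apply_univ] at h
  rw [← h, tsum_univ fun x => μ.restrict E ((fun ω : ℕ → V => ω k) ⁻¹' {x})]
  exact tsum_congr fun x => (Measure.restrict_apply (measurableSet_eval_eq k x)).symm

theorem measure_survival_step (hμ : IsRandomWalk G o μ) (k : ℕ) (x y : V) :
    μ {ω | ((∀ j ≤ k, ω j ∉ z) ∧ ω k = x) ∧ ω (k + 1) = y} = survival μ z k x * G.trans x y := by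
  set B : Set (Fin (k + 1) → V) := {b | (∀ i, b i ∉ z) ∧ b (Fin.last k) = x} with hB
  have hr : {ω : ℕ → V | (∀ j ≤ k, ω j ∉ z) ∧ ω k = x} = initialSegment k ⁻¹' B := by
    ext ω
    simp only [hB, initialSegment, Set.mem_ofPred_eq, Set.mem_preimage, Fin.val_last]
    refine and_congr_left fun _ => ⟨fun h i => h i (Nat.lt_succ_iff.1 i.2), fun h j hj => ?_⟩
    exact h ⟨j, Nat.lt_succ_of_le hj⟩
  have hm : ∀ b : Fin (k + 1) → V, MeasurableSet (initialSegment k ⁻¹' {b}) := fun b =>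
    measurable_initialSegment k (measurableSet_singleton b)
  have hcyl : ∀ b : Fin (k + 1) → V,
      initialSegment k ⁻¹' {b} = {ω | ∀ i : Fin (k + 1), ω (i : ℕ) = b i} := by
    intro b
    ext ω
    simp [initialSegment, funext_iff]
  have h1 := tsum_measure_preimage_singleton (μ := μ) (s := B) (Set.to_countable _)
    (f := initialSegment k) fun b _ => hm b
  have h2 := tsum_measure_preimage_singleton (μ := μ.restrict {ω | ω (k + 1) = y}) (s := B)
    (Set.to_countable _) (f := initialSegment k) fun b _ => hm b
  rw [Measure.restrict_apply (measurable_initialSegment k MeasurableSet.of_discrete)] at h2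
  rw [survival, Set.ofPred_and, hr, ← h1, ← h2, ← ENNReal.tsum_mul_right]
  refine tsum_congr fun b => ?_
  obtain ⟨b, hb, hbx⟩ := b
  rw [Measure.restrict_apply (hm _), hcyl]
  have hs : {ω : ℕ → V | ∀ i : Fin (k + 1), ω (i : ℕ) = b i} ∩ {ω | ω (k + 1) = y}
      = {ω | ∀ i : Fin (k + 1 + 1), ω (i : ℕ) = (Fin.snoc b y : Fin (k + 1 + 1) → V) i} := by
    ext ω
    simp only [Set.mem_inter_iff, Set.mem_ofPred_eq, Fin.forall_fin_succ' (n := k + 1),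
      Fin.snoc_castSucc, Fin.snoc_last, Fin.val_castSucc, Fin.val_last]
  rw [hs, hμ.2, hμ.2, Fin.prod_univ_castSucc]
  have h0 : (Fin.snoc b y : Fin (k + 1 + 1) → V) 0 = b 0 := by
    rw [← Fin.castSucc_zero, Fin.snoc_castSucc]
  have hl : (Fin.snoc b y : Fin (k + 1 + 1) → V) (Fin.last k).castSucc = x := by
    rw [Fin.snoc_castSucc, hbx]
  have hl' : (Fin.snoc b y : Fin (k + 1 + 1) → V) (Fin.last k).succ = y := by
    rw [Fin.succ_last, Fin.snoc_last]
  rw [h0, hl, hl', ← mul_assoc]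
  congr 2
  refine Finset.prod_congr rfl fun i _ => ?_
  rw [Fin.snoc_castSucc, ← Fin.castSucc_succ, Fin.snoc_castSucc]

theorem survival_succ (hμ : IsRandomWalk G o μ) (k : ℕ) {y : V} (hy : y ∉ z) :
    survival μ z (k + 1) y = ∑' x, survival μ z k x * G.trans x y := by
  have : {ω : ℕ → V | (∀ j ≤ k + 1, ω j ∉ z) ∧ ω (k + 1) = y}
      = {ω | (∀ j ≤ k, ω j ∉ z) ∧ ω (k + 1) = y} := by
    ext ω
    refine and_congr_left fun (h : ω (k + 1) = y) => ⟨fun h' j hj => h' j (by omega), ?_⟩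
    intro h' j hj
    rcases hj.lt_or_eq with hj | rfl
    · exact h' j (by omega)
    · exact h ▸ hy
  rw [survival, this, ← tsum_measure_inter_eval μ k]
  refine tsum_congr fun x => ?_
  rw [← measure_survival_step hμ]
  congr 1
  ext ω
  simp only [Set.mem_inter_iff, Set.mem_ofPred_eq]
  tauto

theorem green_eq (hμ : IsRandomWalk G o μ) {y : V} (hy : y ∉ z) :
    green μ z y = (if y = o then 1 else 0) + ∑' x, green μ z x * G.trans x y := by
  rw [green, tsum_eq_zero_add' ENNReal.summable, survival_zero hμ hy]
  simp only [survival_succ hμ _ hy]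
  rw [ENNReal.tsum_comm]
  simp only [green, ENNReal.tsum_mul_right]

theorem tsum_green_le_expHit (z : Set V) (μ : Measure (ℕ → V)) :
    ∑' x, green μ z x ≤ expHit μ z := by
  refine le_trans (le_of_eq ?_) (lintegral_mono (tsum_avoid_le_hitTime z))
  rw [lintegral_tsum fun k => (measurable_one.indicator (measurableSet_avoid z k)).aemeasurable]
  simp only [green]
  rw [ENNReal.tsum_comm]
  refine tsum_congr fun k => ?_
  rw [lintegral_indicator_one (measurableSet_avoid z k), ← tsum_measure_inter_eval μ k]
  refine tsum_congr fun x => ?_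
  rw [survival, Set.ofPred_and, Set.inter_comm]

theorem one_le_expHit (hμ : IsRandomWalk G o μ) (ho : o ∉ z) : 1 ≤ expHit μ z := by
  refine le_trans ?_ (tsum_green_le_expHit z μ)
  calc (1 : ℝ≥0∞) = survival μ z 0 o := by rw [survival_zero hμ ho, if_pos rfl]
    _ ≤ green μ z o := ENNReal.le_tsum _
    _ ≤ _ := ENNReal.le_tsum _

end Walk

section LevelFunction

variable {G : WeightedGraph V} {o : V} {z : Set V}

/-- The possible lengths of paths from `o` to `x`. -/
def pathLengths (G : WeightedGraph V) (o x : V) : Set ℕ :=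
  {k | ∃ p : ℕ → V, p 0 = o ∧ (∀ i, i < k → 0 < G.w (p i) (p (i + 1))) ∧ p k = x}

theorem succ_mem_pathLengths {x y : V} (h : 0 < G.w x y) {k : ℕ} (hk : k ∈ pathLengths G o x) :
    k + 1 ∈ pathLengths G o y := by
  obtain ⟨p, h0, hp, hk⟩ := hk
  refine ⟨fun i => if i ≤ k then p i else y, by simp [h0], fun i hi => ?_, by simp⟩
  rcases (Nat.lt_succ_iff.1 hi).lt_or_eq with hi | rfl
  · have h1 : i + 1 ≤ k := hi
    simp only [hi.le, h1, if_true]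
    exact hp i hi
  · simpa [hk] using h

theorem le_of_mem_pathLengths {n : ℕ} (hd : G.distGE o z n) {x : V} (hx : x ∈ z) {k : ℕ}
    (hk : k ∈ pathLengths G o x) : n ≤ k := by
  obtain ⟨p, h0, hp, hk⟩ := hk
  exact hd k p h0 hp (hk ▸ hx)

/-- The graph distance from `o` to `x`, truncated at `m`. -/
noncomputable def truncDist (G : WeightedGraph V) (o : V) (m : ℕ) (x : V) : ℕ :=
  sInf (pathLengths G o x ∪ {m})

theorem truncDist_le (m : ℕ) (x : V) : truncDist G o m x ≤ m :=
  Nat.sInf_le (Or.inr rfl)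

theorem truncDist_self (m : ℕ) : truncDist G o m o = 0 :=
  Nat.le_zero.1 (Nat.sInf_le (Or.inl ⟨fun _ => o, rfl, fun i hi => by omega, rfl⟩))

theorem truncDist_mem (m : ℕ) (x : V) :
    truncDist G o m x ∈ pathLengths G o x ∨ truncDist G o m x = m :=
  Nat.sInf_mem (s := pathLengths G o x ∪ {m}) ⟨m, Or.inr rfl⟩

theorem truncDist_le_succ (m : ℕ) {x y : V} (h : 0 < G.w x y) :
    truncDist G o m y ≤ truncDist G o m x + 1 := by
  rcases truncDist_mem (G := G) (o := o) m x with hx | hx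
  · exact Nat.sInf_le (Or.inl (succ_mem_pathLengths h hx))
  · rw [hx]; exact (truncDist_le m y).trans (Nat.le_succ m)

theorem truncDist_eq_of_mem {m : ℕ} (hd : G.distGE o z (m + 1)) {x : V} (hx : x ∈ z) :
    truncDist G o m x = m := by
  rcases truncDist_mem (G := G) (o := o) m x with h | h
  · have := le_of_mem_pathLengths hd hx h
    have := truncDist_le (G := G) (o := o) m x
    omega
  · exact h

theorem truncDist_eq_of_adj {m : ℕ} (hd : G.distGE o z (m + 1)) {x y : V} (hy : y ∈ z)
    (h : 0 < G.w x y) : truncDist G o m x = m := by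
  rcases truncDist_mem (G := G) (o := o) m x with h' | h'
  · have := le_of_mem_pathLengths hd hy (succ_mem_pathLengths h h')
    have := truncDist_le (G := G) (o := o) m x
    omega
  · exact h'

end LevelFunction

section HittingTime

variable [MeasurableSpace V] [MeasurableSingletonClass V] [Countable V]
  {G : WeightedGraph V} {o : V} {z : Set V} {μ : Measure (ℕ → V)}

/-- A one-parameter family of lower bounds for the expected hitting time. -/
theorem expHit_lower_bound (hμ : IsRandomWalk G o μ) {m : ℕ} (hd : G.distGE o z (m + 1))
    (hfin : expHit μ z ≠ ⊤) {W : ℝ} (hW : 0 < W) (hzW : G.setWeight z ≤ ENNReal.ofReal W)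
    {s : ℝ} (hs : 0 ≤ s) :
    4 * s * (m - 1) - 2 * s ^ 2 *
        (Real.log ((expHit μ z).toReal / (G.vw o).toReal) + Real.log W + 1)
      ≤ (expHit μ z).toReal := by
  have ho : o ∉ z := fun h => by
    have := le_of_mem_pathLengths hd h (k := 0) ⟨fun _ => o, rfl, fun i hi => by omega, rfl⟩
    omega
  have hvw0 : ∀ x, G.vw x ≠ 0 := fun x => (G.vw_pos x).ne'
  have hvwT : ∀ x, G.vw x ≠ ⊤ := fun x => (G.vw_lt_top x).ne
  have hwT : ∀ x y, G.w x y ≠ ⊤ := fun x y => ne_top_of_le_ne_top (hvwT x) (ENNReal.le_tsum y)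
  have hgsum := tsum_green_le_expHit z μ
  have hgT : ∀ x, green μ z x ≠ ⊤ := fun x =>
    ne_top_of_le_ne_top hfin ((ENNReal.le_tsum x).trans hgsum)
  set u : V → ℝ≥0∞ := fun x => green μ z x / G.vw x with hu
  have huT : ∀ x, u x ≠ ⊤ := fun x => ENNReal.div_ne_top (hgT x) (hvw0 x)
  have hwuT : ∀ x y, G.w x y * u x ≠ ⊤ := fun x y => ENNReal.mul_ne_top (hwT x y) (huT x)
  have hrow : ∀ x, ∑' y, G.w x y * u x = green μ z x := fun x => by
    rw [ENNReal.tsum_mul_right]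
    exact ENNReal.mul_div_cancel (hvw0 x) (hvwT x)
  have htot : ∑' q : V × V, G.w q.1 q.2 * u q.1 = ∑' x, green μ z x := by
    rw [ENNReal.tsum_prod (f := fun x y => G.w x y * u x)]
    exact tsum_congr hrow
  have htotT : ∑' q : V × V, G.w q.1 q.2 * u q.1 ≠ ⊤ :=
    htot ▸ ne_top_of_le_ne_top hfin hgsum
  have hcol : ∀ y ∉ z, ∑' y', G.w y y' * u y = (if y = o then 1 else 0) + ∑' x, G.w x y * u x := by
    intro y hy
    rw [hrow, green_eq hμ hy]
    congr 1
    refine tsum_congr fun x => ?_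
    simp only [hu, WeightedGraph.trans, div_eq_mul_inv]
    ring
  have hcolT : ∀ y, ∑' x, G.w x y * u x ≠ ⊤ := fun y => by
    refine ne_top_of_le_ne_top htotT ?_
    rw [ENNReal.tsum_prod (f := fun x y => G.w x y * u x)]
    exact ENNReal.tsum_le_tsum fun x => ENNReal.le_tsum y
  have hzeq : ∑' q : V × V, (if q.2 ∈ z then G.w q.1 q.2 else 0) = G.setWeight z := by
    rw [ENNReal.tsum_prod (f := fun x y => if y ∈ z then G.w x y else 0), ENNReal.tsum_comm,
      WeightedGraph.setWeight, tsum_subtype z]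
    refine tsum_congr fun y => ?_
    by_cases hy : y ∈ z
    · simp only [hy, if_true, Set.indicator_of_mem, WeightedGraph.vw]
      exact tsum_congr fun x => G.symm x y
    · simp [hy]
  have hzT : ∑' q : V × V, (if q.2 ∈ z then G.w q.1 q.2 else 0) ≠ ⊤ :=
    hzeq ▸ ne_top_of_le_ne_top ENNReal.ofReal_ne_top hzW
  have hite : ∀ q : V × V, (if q.2 ∈ z then (G.w q.1 q.2).toReal else 0)
      = (if q.2 ∈ z then G.w q.1 q.2 else 0).toReal := fun q => by split_ifs <;> simp
  have hpos : ∀ x y, 0 < (G.w x y).toReal → 0 < G.w x y := fun x y h =>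
    (ENNReal.toReal_pos_iff.1 h).1
  have main := flow_lower_bound (w := fun x y => (G.w x y).toReal) (v := fun x => (u x).toReal)
    (z := z) (o := o) (W := W) (g := fun x => (m : ℝ) - truncDist G o m x) (C := m) (s := s)
    (fun _ _ => ENNReal.toReal_nonneg) (fun x y => by rw [G.symm])
    (fun _ => ENNReal.toReal_nonneg) (fun x hx => by simp [hu, green_eq_zero hx]) ho
    (by
      simp only [← ENNReal.toReal_mul]
      exact ENNReal.summable_toReal htotT)
    (fun y hy => by
      simp only [← ENNReal.toReal_mul]
      rw [← ENNReal.tsum_toReal_eq fun x => hwuT x y, ← ENNReal.tsum_toReal_eq fun x => hwuT y x,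
        hcol y hy, ENNReal.toReal_add (by split_ifs <;> simp) (hcolT y)]
      split_ifs <;> simp)
    hW
    (by
      simp only [hite]
      exact ENNReal.summable_toReal hzT)
    (by
      simp only [hite]
      rw [← ENNReal.tsum_toReal_eq fun q => by split_ifs <;> simp [hwT], hzeq]
      exact ENNReal.toReal_le_of_le_ofReal hW.le hzW)
    (fun x => by
      have : (truncDist G o m x : ℝ) ≤ m := by exact_mod_cast truncDist_le m x
      have : (0 : ℝ) ≤ truncDist G o m x := Nat.cast_nonneg _
      rw [abs_le]; constructor <;> linarith)
    (fun x hx => by rw [truncDist_eq_of_mem hd hx, sub_self])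
    (fun x y hy h => by rw [truncDist_eq_of_adj hd hy (hpos x y h), sub_self])
    (fun x y h => by
      have h1 : (truncDist G o m y : ℝ) ≤ truncDist G o m x + 1 := by
        exact_mod_cast truncDist_le_succ m (hpos x y h)
      have h2 : (truncDist G o m x : ℝ) ≤ truncDist G o m y + 1 := by
        exact_mod_cast truncDist_le_succ m (G.symm x y ▸ hpos x y h)
      rw [abs_le]; constructor <;> linarith)
    hs
  simp only [truncDist_self, ← ENNReal.toReal_mul] at main
  rw [← ENNReal.tsum_toReal_eq (f := fun q : V × V => G.w q.1 q.2 * u q.1) fun q => hwuT _ _,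
    htot] at main
  have hle : (∑' x, green μ z x).toReal ≤ (expHit μ z).toReal := ENNReal.toReal_mono hfin hgsum
  have hgo : 1 ≤ green μ z o := by
    rw [green_eq hμ ho, if_pos rfl]; exact le_self_add
  have hu0 : 0 < (u o).toReal :=
    ENNReal.toReal_pos (ENNReal.div_ne_zero.2 ⟨(zero_lt_one.trans_le hgo).ne', hvwT o⟩) (huT o)
  have hlog : Real.log (u o).toReal ≤ Real.log ((expHit μ z).toReal / (G.vw o).toReal) := by
    refine Real.log_le_log hu0 ?_
    rw [hu, ENNReal.toReal_div]
    gcongr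
    exact (ENNReal.le_tsum o).trans hgsum
  have h2 := mul_le_mul_of_nonneg_left hlog (by positivity : 0 ≤ 2 * s ^ 2)
  push_cast at main
  linarith

end HittingTime

/-- Optimizing the quadratic lower bounds when the effective weight ratio is at most `c * n ^ p`. -/
theorem exists_lt_of_quadratic_bounds {c p : ℝ} (hc : 0 < c) (hp : 0 < p) :
    ∃ K : ℝ, ∀ n : ℕ, 2 ≤ n → ∀ A : ℝ, 0 < A →
      (∀ s : ℝ, 0 ≤ s → 4 * s * (n - 2) - 2 * s ^ 2 * (Real.log (A * (c * (n : ℝ) ^ p)) + 1) ≤ A) →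
      2 * (n : ℝ) ^ 2 / ((p + 2) * Real.log n) - K * n < A := by
  set κ : ℝ := 2 * c * Real.exp 1 / (p + 2) with hκ
  refine ⟨9 + 2 * Real.exp κ, fun n hn A hA h => ?_⟩
  have hn2 : (2 : ℝ) ≤ n := by exact_mod_cast hn
  have hn0 : (0 : ℝ) < n := by linarith
  have hlog : 1 / 2 < Real.log n := by
    have := Real.log_two_gt_d9
    have := Real.log_le_log two_pos hn2
    linarith
  have hE := Real.exp_pos κ
  set Λ : ℝ := (p + 2) * Real.log n with hΛ
  have hΛ1 : 1 ≤ Λ := by nlinarith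
  have hΛ0 : 0 < Λ := by linarith
  by_contra! hAle
  rcases lt_or_ge (Real.log n) κ with hκn | hκn
  · have h1 : (n : ℝ) < Real.exp κ := (Real.log_lt_iff_lt_exp hn0).1 hκn
    have h2 : 2 * (n : ℝ) ^ 2 / Λ ≤ 2 * (n : ℝ) ^ 2 := div_le_self (by positivity) hΛ1
    nlinarith
  · have h1 : A ≤ 2 * (n : ℝ) ^ 2 / Λ := by
      have : 0 ≤ (9 + 2 * Real.exp κ) * n := by positivity
      linarith
    have hnp : (0 : ℝ) < (n : ℝ) ^ p := Real.rpow_pos_of_pos hn0 p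
    have h2 : A * (c * (n : ℝ) ^ p) * Real.exp 1 ≤ (n : ℝ) ^ (p + 2) := by
      have e : (n : ℝ) ^ (p + 2) = (n : ℝ) ^ p * (n : ℝ) ^ 2 := by
        rw [Real.rpow_add hn0, Real.rpow_two]
      calc A * (c * (n : ℝ) ^ p) * Real.exp 1
          ≤ 2 * (n : ℝ) ^ 2 / Λ * (c * (n : ℝ) ^ p) * Real.exp 1 := by gcongr
        _ = (n : ℝ) ^ (p + 2) * (κ / Real.log n) := by rw [e, hκ, hΛ]; field_simp
        _ ≤ (n : ℝ) ^ (p + 2) :=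
          mul_le_of_le_one_right (by positivity) ((div_le_one (by linarith)).2 hκn)
    have h3 : Real.log (A * (c * (n : ℝ) ^ p)) + 1 ≤ Λ := by
      have := Real.log_le_log (by positivity) h2
      rwa [Real.log_mul (by positivity) (Real.exp_pos 1).ne', Real.log_exp, Real.log_rpow hn0]
        at this
    have hs : 0 ≤ ((n : ℝ) - 2) / Λ := div_nonneg (by linarith) hΛ0.le
    have h4 := h _ hs
    have h5 := mul_le_mul_of_nonneg_left h3
      (by positivity : 0 ≤ 2 * (((n : ℝ) - 2) / Λ) ^ 2)
    have e1 : 4 * (((n : ℝ) - 2) / Λ) * (n - 2) - 2 * (((n : ℝ) - 2) / Λ) ^ 2 * Λ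
        = 2 * (n : ℝ) ^ 2 / Λ - 8 * n / Λ + 8 / Λ := by field_simp; ring
    have h6 : 8 * (n : ℝ) / Λ ≤ 8 * n := div_le_self (by positivity) hΛ1
    have h7 : 0 < 8 / Λ := by positivity
    nlinarith

/-- Uniform polynomial-scaling lower bound: there is `K = K(c,p)` such
that every weighted graph with `dist(o,z) ≥ n` and `w_z/w_o ≤ c n^p` (for `n ≥ 2`) has
`E T_{oz} > 2n²/((p+2) log n) - K n`. -/
theorem expected_hitting_time_polynomial_lower_bound
    (c p : ℝ) (hc : 0 < c) (hp : 0 < p) :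
    ∃ K : ℝ,
      ∀ n : ℕ, 2 ≤ n →
        ∀ (V : Type) (_ : Countable V) (_ : MeasurableSpace V), MeasurableSingletonClass V →
          ∀ (G : WeightedGraph V) (o : V) (z : Set V) (μ : Measure (ℕ → V)),
            IsRandomWalk G o μ → G.distGE o z n →
            G.setWeight z / G.vw o ≤ ENNReal.ofReal (c * (n : ℝ) ^ p) →
            ENNReal.ofReal (2 * (n : ℝ) ^ 2 / ((p + 2) * Real.log n) - K * n)
              < expHit μ z := by
  obtain ⟨K, hK⟩ := exists_lt_of_quadratic_bounds hc hp
  refine ⟨K, fun n hn V _ _ _ G o z μ hμ hd hz => ?_⟩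
  obtain ⟨m, rfl⟩ : ∃ m, n = m + 1 := ⟨n - 1, by omega⟩
  have ho : o ∉ z := fun h => by
    have := hd 0 (fun _ => o) rfl (fun i hi => by omega) h
    omega
  rcases eq_or_ne (expHit μ z) ⊤ with htop | hfin
  · rw [htop]; exact ENNReal.ofReal_lt_top
  have hE : 0 < (expHit μ z).toReal :=
    ENNReal.toReal_pos (zero_lt_one.trans_le (one_le_expHit hμ ho)).ne' hfin
  have hvT : G.vw o ≠ ⊤ := (G.vw_lt_top o).ne
  have hv0 : 0 < (G.vw o).toReal := ENNReal.toReal_pos (G.vw_pos o).ne' hvT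
  have hR : 0 < c * ((m + 1 : ℕ) : ℝ) ^ p := by positivity
  have hzW : G.setWeight z ≤
      ENNReal.ofReal (c * ((m + 1 : ℕ) : ℝ) ^ p * (G.vw o).toReal) := by
    rw [ENNReal.ofReal_mul hR.le, ENNReal.ofReal_toReal hvT]
    exact (ENNReal.div_le_iff (G.vw_pos o).ne' hvT).1 hz
  rw [← ENNReal.ofReal_toReal hfin, ENNReal.ofReal_lt_ofReal_iff hE]
  refine hK _ hn _ hE fun s hs => ?_
  have h := expHit_lower_bound hμ hd hfin (mul_pos hR hv0) hzW hs
  rw [← Real.log_mul (by positivity) (by positivity)] at h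
  have e : (expHit μ z).toReal / (G.vw o).toReal *
      (c * ((m + 1 : ℕ) : ℝ) ^ p * (G.vw o).toReal)
      = (expHit μ z).toReal * (c * ((m + 1 : ℕ) : ℝ) ^ p) := by field_simp
  rw [e] at h
  have e' : (((m + 1 : ℕ) : ℝ) - 2) = m - 1 := by push_cast; ring
  rwa [e']

end RWHitting
end

section
/- Let p ≥ 0 and C > 0, and let G be an infinite weighted graph with fixed vertex o having polynomial boundary growth with power p, i.e. w_n ≤ C n^p for all n ≥ 1. Then the random walk (X_k) on G started at o satisfies limsup_{k→∞} |X_k|/√(k log k) ≤ √(p+2)/2 almost surely, where |v| := dist(o,v). -/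
open MeasureTheory Filter
open scoped Classical ENNReal

namespace RWHitting

variable {V : Type*}

theorem four_mul_sq_sqrt_sub_sqrt_le {a b : ℝ} (ha : 0 < a) (hb : 0 < b) :
    4 * (√a - √b) ^ 2 ≤ (a - b) * (Real.log a - Real.log b) := by
  wlog hab : b ≤ a generalizing a b
  · have := this hb ha (le_of_not_ge hab)
    nlinarith
  obtain ⟨u, hu, rfl⟩ : ∃ u, 0 < u ∧ a = u ^ 2 :=
    ⟨√a, Real.sqrt_pos.2 ha, (Real.sq_sqrt ha.le).symm⟩
  obtain ⟨v, hv, rfl⟩ : ∃ u, 0 < u ∧ b = u ^ 2 :=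
    ⟨√b, Real.sqrt_pos.2 hb, (Real.sq_sqrt hb.le).symm⟩
  have huv : v ≤ u := by
    by_contra! h
    nlinarith
  rw [Real.sqrt_sq hu.le, Real.sqrt_sq hv.le, Real.log_pow, Real.log_pow]
  have h := Real.le_log_one_add_of_nonneg (x := u / v - 1) (by
    rw [sub_nonneg, le_div_iff₀ hv]; linarith)
  rw [show 1 + (u / v - 1) = u / v by ring, Real.log_div hu.ne' hv.ne',
    show 2 * (u / v - 1) / (u / v - 1 + 2) = 2 * (u - v) / (u + v) by
      rw [show u / v - 1 + 2 = (u + v) / v by field_simp; ring,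
        show u / v - 1 = (u - v) / v by field_simp]
      field_simp,
    div_le_iff₀ (by positivity)] at h
  push_cast
  nlinarith [mul_le_mul_of_nonneg_left h (sub_nonneg.2 huv)]

section FiniteNetwork

variable {ι : Type*} [Fintype ι] {w : ι → ι → ℝ} {c W h f ρ : ι → ℝ} {o : ι} {r : ℝ}

/-- Discounted flow conservation for the `f`-transform of a killed reversible network: `h` is the
density of the discounted occupation measure from `o`, and `f` the discounted exit probability. -/
theorem sum_flow_mul_sub (hsymm : ∀ x y, w x y = w y x)
    (hh : ∀ x, W x * h x = (if x = o then 1 else 0) + r * ∑ y, w x y * h y)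
    (hf : ∀ x, W x * f x = r * (∑ y, w x y * f y + c x)) (φ : ι → ℝ) :
    ∑ x, ∑ y, r * w x y * h x * f y * (φ y - φ x)
      = ∑ x, r * h x * c x * φ x - f o * φ o := by
  have h1 : ∑ x, ∑ y, r * w x y * h x * f y * φ y
      = ∑ x, φ x * f x * (W x * h x - if x = o then 1 else 0) := by
    rw [Finset.sum_comm]
    refine Finset.sum_congr rfl fun y _ => ?_
    rw [hh y, add_sub_cancel_left, Finset.mul_sum, Finset.mul_sum]
    refine Finset.sum_congr rfl fun x _ => ?_
    rw [hsymm x y]; ring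
  have h2 : ∑ x, ∑ y, r * w x y * h x * f y * φ x
      = ∑ x, φ x * h x * (W x * f x - r * c x) := by
    refine Finset.sum_congr rfl fun x _ => ?_
    rw [hf x, mul_add, add_sub_cancel_right, Finset.mul_sum, Finset.mul_sum]
    refine Finset.sum_congr rfl fun y _ => ?_
    ring
  simp only [mul_sub, Finset.sum_sub_distrib]
  have h3 : ∑ x, φ x * f x * (if x = o then (1 : ℝ) else 0) = f o * φ o := by
    simp [mul_comm]
  have h4 : ∑ x, φ x * f x * (W x * h x) = ∑ x, φ x * h x * (W x * f x) :=
    Finset.sum_congr rfl fun x _ => by ring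
  have h5 : ∑ x, φ x * h x * (r * c x) = ∑ x, r * h x * c x * φ x :=
    Finset.sum_congr rfl fun x _ => by ring
  simp only [mul_sub, Finset.sum_sub_distrib] at h1 h2
  rw [h1, h2, h3, h4, h5]
  ring

/-- The discounted exit flow equals the discounted exit probability. -/
theorem sum_exit_flow (hsymm : ∀ x y, w x y = w y x)
    (hh : ∀ x, W x * h x = (if x = o then 1 else 0) + r * ∑ y, w x y * h y)
    (hf : ∀ x, W x * f x = r * (∑ y, w x y * f y + c x)) :
    ∑ x, r * h x * c x = f o := by
  have := sum_flow_mul_sub hsymm hh hf (fun _ => 1)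
  simp at this
  linarith

/-- The total discounted occupation time is at most `1 / (1 - r)`. -/
theorem occupation_le (hsymm : ∀ x y, w x y = w y x) (hw : ∀ x y, 0 ≤ w x y)
    (hc : ∀ x, 0 ≤ c x)
    (hW : ∀ x, ∑ y, w x y + c x ≤ W x) (hr0 : 0 < r) (hr1 : r < 1) (hhn : ∀ x, 0 ≤ h x)
    (hh : ∀ x, W x * h x = (if x = o then 1 else 0) + r * ∑ y, w x y * h y) :
    W o * h o ≤ 1 / (1 - r) := by
  have h1 : ∑ x, W x * h x = 1 + r * ∑ x, ∑ y, w x y * h y := by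
    simp_rw [hh, Finset.sum_add_distrib, ← Finset.mul_sum]
    simp
  have h2 : ∑ x, ∑ y, w x y * h y ≤ ∑ x, W x * h x := by
    rw [Finset.sum_comm]
    refine Finset.sum_le_sum fun y _ => ?_
    rw [← Finset.sum_mul]
    refine mul_le_mul_of_nonneg_right ?_ (hhn y)
    simp_rw [hsymm _ y]
    linarith [hW y, hc y]
  have hWn : ∀ x, 0 ≤ W x := fun x =>
    le_trans (add_nonneg (Finset.sum_nonneg fun y _ => hw x y) (hc x)) (hW x)
  have h3 : W o * h o ≤ ∑ x, W x * h x :=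
    Finset.single_le_sum (f := fun x => W x * h x)
      (fun x _ => mul_nonneg (hWn x) (hhn x)) (Finset.mem_univ o)
  rw [le_div_iff₀ (by linarith)]
  nlinarith

/-- The expected exit time under the discounted law is controlled by the entropy of the
discounting. -/
theorem log_mul_sum_le (hsymm : ∀ x y, w x y = w y x) (hw : ∀ x y, 0 ≤ w x y)
    (hc : ∀ x, 0 ≤ c x) (hWpos : ∀ x, 0 < W x)
    (hW : ∀ x, ∑ y, w x y + c x ≤ W x) (hr0 : 0 < r) (hhn : ∀ x, 0 ≤ h x)
    (hfn : ∀ x, 0 ≤ f x)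
    (hh : ∀ x, W x * h x = (if x = o then 1 else 0) + r * ∑ y, w x y * h y)
    (hf : ∀ x, W x * f x = r * (∑ y, w x y * f y + c x)) :
    -Real.log r * ∑ x, W x * h x * f x ≤ Real.negMulLog (f o) := by
  set η := Real.negMulLog
  have key : ∀ x, W x * (-Real.log r * f x) ≤ W x * η (f x) - r * ∑ y, w x y * η (f y) := by
    intro x
    set m := (∑ y, w x y * f y + c x) / W x with hm
    have hfm : f x = r * m := by
      rw [hm, mul_div_assoc', eq_div_iff (hWpos x).ne', ← hf x, mul_comm]
    have hmn : 0 ≤ m := div_nonneg (add_nonneg (Finset.sum_nonneg fun y _ =>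
      mul_nonneg (hw x y) (hfn y)) (hc x)) (hWpos x).le
    have hηx : η (f x) = m * η r + r * η m := by
      rw [hfm]; exact Real.negMulLog_mul r m
    -- concavity in tangent form
    have htan : ∀ z, 0 ≤ z → 0 < m → η z ≤ η m + (-Real.log m - 1) * (z - m) := by
      intro z hz hm0
      rcases hz.eq_or_lt with rfl | hz
      · simp only [η, Real.negMulLog]; simp; nlinarith
      · have := Real.log_le_sub_one_of_pos (div_pos hm0 hz)
        rw [Real.log_div hm0.ne' hz.ne'] at this
        have h2 := mul_le_mul_of_nonneg_left this hz.le
        rw [mul_sub, mul_sub, mul_div_cancel₀ _ hz.ne'] at h2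
        simp only [η, Real.negMulLog]
        nlinarith
    have hJ : ∑ y, w x y * η (f y) ≤ W x * η m := by
      rcases hmn.eq_or_lt with hm0 | hm0
      · have h0 : ∑ y, w x y * f y + c x = 0 := by
          have := hm0.symm
          rw [hm, div_eq_zero_iff] at this
          exact this.resolve_right (hWpos x).ne'
        have h1 : ∑ y, w x y * f y = 0 := le_antisymm (by linarith [hc x])
          (Finset.sum_nonneg fun y _ => mul_nonneg (hw x y) (hfn y))
        rw [Finset.sum_eq_zero_iff_of_nonneg fun y _ => mul_nonneg (hw x y) (hfn y)] at h1
        rw [← hm0]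
        simp only [η, Real.negMulLog_zero, mul_zero]
        refine (Finset.sum_eq_zero fun y hy => ?_).le
        rcases mul_eq_zero.1 (h1 y hy) with h | h
        · simp [h]
        · simp [h]
      · have h1 : ∑ y, w x y * η (f y)
            ≤ ∑ y, w x y * (η m + (-Real.log m - 1) * (f y - m)) :=
          Finset.sum_le_sum fun y _ => mul_le_mul_of_nonneg_left (htan _ (hfn y) hm0) (hw x y)
        have h2 : ∑ y, w x y * (η m + (-Real.log m - 1) * (f y - m))
            = m * ∑ y, w x y + (-Real.log m - 1) * ∑ y, w x y * f y := by
          rw [Finset.mul_sum, Finset.mul_sum, ← Finset.sum_add_distrib]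
          refine Finset.sum_congr rfl fun y _ => ?_
          simp only [η, Real.negMulLog]; ring
        have h3 : ∑ y, w x y * f y = W x * m - c x := by
          rw [hm, mul_div_cancel₀ _ (hWpos x).ne']; ring
        have h4 := htan 1 zero_le_one hm0
        simp only [η, Real.negMulLog_one] at h4
        rw [h2, h3] at h1
        refine h1.trans ?_
        have h5 := mul_le_mul_of_nonneg_left (hW x) hm0.le
        have h6 := mul_nonneg (hc x) (sub_nonneg.2 h4)
        simp only [η, Real.negMulLog] at h6 ⊢
        nlinarith
    have hr' : η r = r * -Real.log r := by simp only [η, Real.negMulLog]; ring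
    rw [hηx, hr', hfm]
    nlinarith [mul_le_mul_of_nonneg_left hJ hr0.le]
  have h1 : ∑ x, h x * (W x * η (f x) - r * ∑ y, w x y * η (f y)) = η (f o) := by
    have h2 : ∑ x, h x * (r * ∑ y, w x y * η (f y))
        = ∑ x, η (f x) * (W x * h x - if x = o then 1 else 0) := by
      simp_rw [hh, add_sub_cancel_left, Finset.mul_sum]
      rw [Finset.sum_comm]
      refine Finset.sum_congr rfl fun y _ => Finset.sum_congr rfl fun x _ => ?_
      rw [hsymm x y]; ring
    simp only [mul_sub, Finset.sum_sub_distrib] at h2 ⊢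
    rw [h2]
    have h3 : ∑ x, η (f x) * (if x = o then (1 : ℝ) else 0) = η (f o) := by simp
    have h4 : ∑ x, η (f x) * (W x * h x) = ∑ x, h x * (W x * η (f x)) :=
      Finset.sum_congr rfl fun x _ => by ring
    rw [h3, h4]; ring
  rw [← h1, Finset.mul_sum]
  refine Finset.sum_le_sum fun x _ => ?_
  have := mul_le_mul_of_nonneg_left (key x) (hhn x)
  linarith

theorem occupation_pos_and_exit_pos (hsymm : ∀ x y, w x y = w y x) (hw : ∀ x y, 0 ≤ w x y)
    (hc : ∀ x, 0 ≤ c x) (hr0 : 0 < r) (hhn : ∀ x, 0 ≤ h x) (hWpos : ∀ x, 0 < W x)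
    (hh : ∀ x, W x * h x = (if x = o then 1 else 0) + r * ∑ y, w x y * h y)
    (hf : ∀ x, W x * f x = r * (∑ y, w x y * f y + c x)) (hfo : 0 < f o) :
    0 < h o ∧ 0 < ∑ x, c x := by
  refine ⟨?_, ?_⟩
  · have h1 := hh o
    rw [if_pos rfl] at h1
    have : 0 ≤ ∑ y, w o y * h y := Finset.sum_nonneg fun y _ => mul_nonneg (hw o y) (hhn y)
    have h3 : 0 < W o * h o := by rw [h1]; positivity
    exact (pos_iff_pos_of_mul_pos h3).1 (hWpos o)
  · refine lt_of_le_of_ne (Finset.sum_nonneg fun x _ => hc x) fun h0 => hfo.ne' ?_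
    rw [eq_comm, Finset.sum_eq_zero_iff_of_nonneg fun x _ => hc x] at h0
    rw [← sum_exit_flow hsymm hh hf]
    exact Finset.sum_eq_zero fun x hx => by simp [h0 x hx]

/-- The entropy bound for the symmetrized flow. -/
theorem sum_sq_sqrt_flow_le (hsymm : ∀ x y, w x y = w y x) (hw : ∀ x y, 0 ≤ w x y)
    (hc : ∀ x, 0 ≤ c x) (hr0 : 0 < r) (hhn : ∀ x, 0 ≤ h x)
    (hfn : ∀ x, 0 ≤ f x) (hf1 : ∀ x, f x ≤ 1) (hr1 : r < 1) (hWpos : ∀ x, 0 < W x)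
    (hh : ∀ x, W x * h x = (if x = o then 1 else 0) + r * ∑ y, w x y * h y)
    (hf : ∀ x, W x * f x = r * (∑ y, w x y * f y + c x)) (hfo : 0 < f o) :
    2 * ∑ x, ∑ y, (√(r * w x y * h x * f y) - √(r * w y x * h y * f x)) ^ 2
      ≤ f o * (-2 * Real.log (f o) + Real.log (h o * ∑ x, c x)) := by
  have hhz : ∀ x y, 0 < w x y → h x = 0 → h y = 0 := by
    intro x y hxy hx
    have h1 := hh x
    rw [hx, mul_zero] at h1
    have h2 : ∀ y ∈ Finset.univ, 0 ≤ w x y * h y := fun y _ => mul_nonneg (hw x y) (hhn y)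
    have h3 := Finset.single_le_sum h2 (Finset.mem_univ y)
    have h4 : 0 ≤ (if x = o then (1 : ℝ) else 0) := by split_ifs <;> norm_num
    have h5 : ∑ y, w x y * h y ≤ 0 := by
      by_contra! h6
      nlinarith [mul_pos hr0 h6]
    have h6 := hhn y
    by_contra h7
    have := mul_pos hxy (lt_of_le_of_ne h6 (Ne.symm h7))
    linarith
  have hfz : ∀ x y, 0 < w x y → f x = 0 → f y = 0 := by
    intro x y hxy hx
    have h1 := hf x
    rw [hx, mul_zero] at h1
    have h2 : ∀ y ∈ Finset.univ, 0 ≤ w x y * f y := fun y _ => mul_nonneg (hw x y) (hfn y)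
    have h3 := Finset.single_le_sum h2 (Finset.mem_univ y)
    have h5 : ∑ y, w x y * f y ≤ 0 := by
      by_contra! h6
      nlinarith [mul_pos hr0 h6, mul_nonneg hr0.le (hc x)]
    by_contra h7
    have := mul_pos hxy (lt_of_le_of_ne (hfn y) (Ne.symm h7))
    linarith
  set Φ : ι → ℝ := fun x => Real.log (f x) - Real.log (h x) with hΦ
  set M : ι → ι → ℝ := fun x y => r * w x y * h x * f y with hM
  have hterm : ∀ x y, 4 * (√(M x y) - √(M y x)) ^ 2 ≤ (M x y - M y x) * (Φ y - Φ x) := by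
    intro x y
    rcases (hw x y).eq_or_lt with h0 | h0
    · simp [hM, ← h0, ← hsymm x y]
    rcases (hhn x).eq_or_lt with h1 | h1
    · simp [hM, ← h1, hhz x y h0 h1.symm]
    rcases (hfn x).eq_or_lt with h2 | h2
    · simp [hM, ← h2, hfz x y h0 h2.symm]
    have h0' : 0 < w y x := by rwa [hsymm y x]
    have h3 : 0 < h y := lt_of_le_of_ne (hhn y) fun h => h1.ne' (hhz y x h0' h.symm)
    have h4 : 0 < f y := lt_of_le_of_ne (hfn y) fun h => h2.ne' (hfz y x h0' h.symm)
    have h5 := four_mul_sq_sqrt_sub_sqrt_le (a := M x y) (b := M y x)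
      (by simp only [hM]; positivity) (by simp only [hM]; positivity)
    refine h5.trans_eq ?_
    congr 1
    simp only [hM, hΦ]
    rw [Real.log_mul (by positivity) h4.ne', Real.log_mul (by positivity) h1.ne',
      Real.log_mul (by positivity) h2.ne', Real.log_mul (by positivity) h3.ne', hsymm y x]
    ring
  have hsum : ∑ x, ∑ y, 4 * (√(M x y) - √(M y x)) ^ 2
      ≤ 2 * ∑ x, ∑ y, M x y * (Φ y - Φ x) := by
    refine (Finset.sum_le_sum fun x _ => Finset.sum_le_sum fun y _ => hterm x y).trans_eq ?_
    have : ∑ x, ∑ y, M y x * (Φ y - Φ x) = - ∑ x, ∑ y, M x y * (Φ y - Φ x) := by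
      rw [Finset.sum_comm]
      simp only [← Finset.sum_neg_distrib]
      refine Finset.sum_congr rfl fun y _ => Finset.sum_congr rfl fun x _ => ?_
      ring
    simp only [sub_mul, Finset.sum_sub_distrib, this]
    ring
  have hflow := sum_flow_mul_sub hsymm hh hf Φ
  have hexit := sum_exit_flow hsymm hh hf
  obtain ⟨hho, hSpos⟩ := occupation_pos_and_exit_pos hsymm hw hc hr0 hhn hWpos hh hf hfo
  set S := ∑ x, c x with hS
  have hexitlog : ∑ x, r * h x * c x * Φ x ≤ f o * (Real.log S - Real.log (f o)) := by
    have h1 : ∀ x, r * h x * c x * Φ x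
        ≤ f o / S * c x + r * h x * c x * (Real.log S - Real.log (f o) - 1) := by
      intro x
      rcases (hhn x).eq_or_lt with h0 | h0
      · rw [← h0]
        have := hc x
        simp only [mul_zero, zero_mul, add_zero]
        positivity
      have hrh : r * h x * c x * Φ x ≤ r * h x * c x * (- Real.log (h x)) := by
        refine mul_le_mul_of_nonneg_left ?_ (by have := hc x; positivity)
        have := Real.log_nonpos (hfn x) (hf1 x)
        simp only [hΦ]; linarith
      refine hrh.trans ?_
      have h2 := Real.log_le_sub_one_of_pos (x := f o / (S * h x)) (by positivity)
      rw [Real.log_div hfo.ne' (by positivity), Real.log_mul hSpos.ne' h0.ne'] at h2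
      have h3 : r * h x * c x * (f o / (S * h x)) ≤ f o / S * c x := by
        have : r * h x * c x * (f o / (S * h x)) = r * (f o / S * c x) := by field_simp
        rw [this]
        have h4 : 0 ≤ f o / S * c x := mul_nonneg (by positivity) (hc x)
        nlinarith
      have h4 := mul_le_mul_of_nonneg_left h2 (show 0 ≤ r * h x * c x by
        have := hc x; positivity)
      nlinarith
    refine (Finset.sum_le_sum fun x _ => h1 x).trans_eq ?_
    rw [Finset.sum_add_distrib, ← Finset.mul_sum, ← Finset.sum_mul, hexit, ← hS,
      div_mul_cancel₀ _ hSpos.ne']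
    ring
  have h4 : ∑ x, ∑ y, 4 * (√(M x y) - √(M y x)) ^ 2
      = 4 * ∑ x, ∑ y, (√(M x y) - √(M y x)) ^ 2 := by
    simp_rw [← Finset.mul_sum]
  rw [h4] at hsum
  rw [Real.log_mul hho.ne' hSpos.ne']
  have h5 : f o * Φ o = f o * (Real.log (f o) - Real.log (h o)) := rfl
  have h6 : ∑ x, ∑ y, M x y * (Φ y - Φ x) = _ := hflow
  rw [h6] at hsum
  linarith

/-- Quantitative lower bound on the logarithmic discounted exit probability. -/
theorem exit_distance_bound {D K : ℝ} (hsymm : ∀ x y, w x y = w y x) (hw : ∀ x y, 0 ≤ w x y)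
    (hc : ∀ x, 0 ≤ c x) (hWpos : ∀ x, 0 < W x)
    (hW : ∀ x, ∑ y, w x y + c x ≤ W x) (hr0 : 0 < r) (hr1 : r < 1) (hhn : ∀ x, 0 ≤ h x)
    (hfn : ∀ x, 0 ≤ f x) (hf1 : ∀ x, f x ≤ 1)
    (hh : ∀ x, W x * h x = (if x = o then 1 else 0) + r * ∑ y, w x y * h y)
    (hf : ∀ x, W x * f x = r * (∑ y, w x y * f y + c x)) (hfo : 0 < f o)
    (hρo : ρ o = 0) (hρ : ∀ x y, 0 < w x y → |ρ y - ρ x| ≤ 1)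
    (hρc : ∀ x, 0 < c x → D ≤ ρ x) (hD : 0 ≤ D) (hK : ∑ x, c x ≤ K) :
    2 * -Real.log r * D ^ 2
      ≤ -Real.log (f o) * (-2 * Real.log (f o) + Real.log (K / (W o * (1 - r)))) := by
  refine le_trans ?_ (mul_le_mul_of_nonneg_left (b := -2 * Real.log (f o) +
    Real.log (h o * ∑ x, c x)) ?_ (neg_nonneg.2 (Real.log_nonpos (hfn o) (hf1 o))))
  swap
  · obtain ⟨hho, hSpos⟩ := occupation_pos_and_exit_pos hsymm hw hc hr0 hhn hWpos hh hf hfo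
    have h1 := occupation_le hsymm hw hc hW hr0 hr1 hhn hh
    have h2 : 0 < 1 - r := sub_pos.2 hr1
    gcongr
    rw [le_div_iff₀ (mul_pos (hWpos o) h2)]
    rw [le_div_iff₀ h2] at h1
    nlinarith [mul_le_mul_of_nonneg_left h1 hSpos.le]
  set M : ι → ι → ℝ := fun x y => r * w x y * h x * f y with hM
  have hMn : ∀ x y, 0 ≤ M x y := fun x y =>
    mul_nonneg (mul_nonneg (mul_nonneg hr0.le (hw x y)) (hhn x)) (hfn y)
  have hE : 2 * ∑ x, ∑ y, (√(M x y) - √(M y x)) ^ 2 ≤ _ :=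
    sum_sq_sqrt_flow_le hsymm hw hc hr0 hhn hfn hf1 hr1 hWpos hh hf hfo
  have hT := log_mul_sum_le hsymm hw hc hWpos hW hr0 hhn hfn hh hf
  have hflow : ∑ x, ∑ y, M x y * (ρ y - ρ x) = _ := sum_flow_mul_sub hsymm hh hf ρ
  have hexit := sum_exit_flow hsymm hh hf
  have hDs : D * f o ≤ ∑ x, ∑ y, M x y * (ρ y - ρ x) := by
    rw [hflow, hρo, mul_zero, sub_zero, ← hexit, Finset.mul_sum]
    refine Finset.sum_le_sum fun x _ => ?_
    rcases (hc x).eq_or_lt with h0 | h0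
    · simp [← h0]
    · rw [mul_comm]
      exact mul_le_mul_of_nonneg_left (hρc x h0) (mul_nonneg (mul_nonneg hr0.le (hhn x)) (hc x))
  have hanti : 2 * ∑ x, ∑ y, M x y * (ρ y - ρ x)
      = ∑ x, ∑ y, (M x y - M y x) * (ρ y - ρ x) := by
    have : ∑ x, ∑ y, M y x * (ρ y - ρ x) = - ∑ x, ∑ y, M x y * (ρ y - ρ x) := by
      rw [Finset.sum_comm]
      simp only [← Finset.sum_neg_distrib]
      refine Finset.sum_congr rfl fun y _ => Finset.sum_congr rfl fun x _ => ?_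
      ring
    simp only [sub_mul, Finset.sum_sub_distrib, this]
    ring
  have habs : ∑ x, ∑ y, (M x y - M y x) * (ρ y - ρ x)
      ≤ ∑ x, ∑ y, |√(M x y) - √(M y x)| * (√(M x y) + √(M y x)) := by
    refine Finset.sum_le_sum fun x _ => Finset.sum_le_sum fun y _ => ?_
    have h1 : |M x y - M y x| = |√(M x y) - √(M y x)| * (√(M x y) + √(M y x)) := by
      rw [← abs_of_nonneg (add_nonneg (Real.sqrt_nonneg (M x y)) (Real.sqrt_nonneg (M y x))),
        ← abs_mul]
      congr 1
      nlinarith [Real.sq_sqrt (hMn x y), Real.sq_sqrt (hMn y x)]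
    rw [← h1]
    rcases (hw x y).eq_or_lt with h0 | h0
    · simp [hM, ← h0, ← hsymm x y]
    · refine (le_abs_self _).trans ?_
      rw [abs_mul]
      exact mul_le_of_le_one_right (abs_nonneg _) (hρ x y h0)
  have hCS : (∑ x, ∑ y, |√(M x y) - √(M y x)| * (√(M x y) + √(M y x))) ^ 2
      ≤ (∑ x, ∑ y, (√(M x y) - √(M y x)) ^ 2) * ∑ x, ∑ y, (√(M x y) + √(M y x)) ^ 2 := by
    simp_rw [← Fintype.sum_prod_type']
    have := Finset.sum_mul_sq_le_sq_mul_sq Finset.univ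
      (fun q : ι × ι => |√(M q.1 q.2) - √(M q.2 q.1)|)
      (fun q : ι × ι => √(M q.1 q.2) + √(M q.2 q.1))
    simpa only [sq_abs] using this
  have hMsum : ∑ x, ∑ y, M x y ≤ ∑ x, W x * h x * f x := by
    refine Finset.sum_le_sum fun x _ => ?_
    have h1 : W x * h x * f x = h x * (r * (∑ y, w x y * f y + c x)) := by rw [← hf]; ring
    have h2 : ∑ y, M x y = h x * (r * ∑ y, w x y * f y) := by
      rw [Finset.mul_sum, Finset.mul_sum]
      exact Finset.sum_congr rfl fun y _ => by simp only [hM]; ring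
    rw [h1, h2]
    refine mul_le_mul_of_nonneg_left (mul_le_mul_of_nonneg_left ?_ hr0.le) (hhn x)
    linarith [hc x]
  have hplus : ∑ x, ∑ y, (√(M x y) + √(M y x)) ^ 2 ≤ 4 * ∑ x, ∑ y, M x y := by
    have h1 : ∑ x, ∑ y, (√(M x y) + √(M y x)) ^ 2 ≤ ∑ x, ∑ y, (2 * M x y + 2 * M y x) := by
      refine Finset.sum_le_sum fun x _ => Finset.sum_le_sum fun y _ => ?_
      nlinarith [Real.sq_sqrt (hMn x y), Real.sq_sqrt (hMn y x),
        sq_nonneg (√(M x y) - √(M y x))]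
    refine h1.trans_eq ?_
    simp only [Finset.sum_add_distrib, ← Finset.mul_sum]
    rw [Finset.sum_comm (f := fun x y => M y x)]
    ring
  set E := ∑ x, ∑ y, (√(M x y) - √(M y x)) ^ 2
  set T := ∑ x, W x * h x * f x
  set L := -2 * Real.log (f o) + Real.log (h o * ∑ x, c x)
  have hE0 : 0 ≤ E := Finset.sum_nonneg fun x _ => Finset.sum_nonneg fun y _ => sq_nonneg _
  have hlr : 0 < -Real.log r := neg_pos.2 (Real.log_neg hr0 hr1)
  have h1 : (2 * (D * f o)) ^ 2 ≤ E * (4 * T) := by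
    calc (2 * (D * f o)) ^ 2
        ≤ (∑ x, ∑ y, |√(M x y) - √(M y x)| * (√(M x y) + √(M y x))) ^ 2 := by
          refine pow_le_pow_left₀ (by positivity) ?_ 2
          linarith
      _ ≤ _ := hCS
      _ ≤ E * (4 * T) := mul_le_mul_of_nonneg_left (by linarith) hE0
  have hL : 0 ≤ L := by
    by_contra! hL
    nlinarith [mul_neg_of_pos_of_neg hfo hL]
  rw [Real.negMulLog] at hT
  have h2 : (f o) ^ 2 * (2 * -Real.log r * D ^ 2) ≤ (f o) ^ 2 * (-Real.log (f o) * L) := by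
    calc (f o) ^ 2 * (2 * -Real.log r * D ^ 2) = -Real.log r * (2 * (D * f o)) ^ 2 / 2 := by ring
      _ ≤ -Real.log r * (E * (4 * T)) / 2 := by gcongr
      _ = (2 * E) * (-Real.log r * T) := by ring
      _ ≤ (f o * L) * (-f o * Real.log (f o)) := by
          refine mul_le_mul hE hT ?_ (by positivity)
          have : 0 ≤ T := Finset.sum_nonneg fun x _ =>
            mul_nonneg (mul_nonneg (hWpos x).le (hhn x)) (hfn x)
          positivity
      _ = _ := by ring
  exact le_of_mul_le_mul_left h2 (by positivity)

end FiniteNetwork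

namespace WeightedGraph

variable {V : Type*} (G : WeightedGraph V)

theorem vw_ne_zero (x : V) : G.vw x ≠ 0 := (G.vw_pos x).ne'

theorem vw_ne_top (x : V) : G.vw x ≠ ⊤ := (G.vw_lt_top x).ne

theorem vw_mul_trans (x y : V) : G.vw x * G.trans x y = G.w x y :=
  ENNReal.mul_div_cancel (G.vw_ne_zero x) (G.vw_ne_top x)

theorem tsum_trans (x : V) : ∑' y, G.trans x y = 1 := by
  simp only [trans, div_eq_mul_inv]
  rw [ENNReal.tsum_mul_right]
  exact ENNReal.mul_inv_cancel (G.vw_ne_zero x) (G.vw_ne_top x)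

/-- One step of the walk, killed when it leaves `s`. -/
noncomputable def killedStep (s : Set V) (φ : V → ℝ≥0∞) (x : V) : ℝ≥0∞ :=
  if x ∈ s then ∑' y, G.trans x y * φ y else 0

/-- The discounted sum of the iterates of `killedStep`. -/
noncomputable def resolvent (s : Set V) (r : ℝ≥0∞) (φ : V → ℝ≥0∞) (x : V) : ℝ≥0∞ :=
  ∑' k : ℕ, r ^ k * (G.killedStep s)^[k] φ x

variable {G} {s : Set V} {r : ℝ≥0∞} {φ : V → ℝ≥0∞}

theorem killedStep_of_notMem {x : V} (hx : x ∉ s) : G.killedStep s φ x = 0 := if_neg hx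

theorem killedStep_le {c : ℝ≥0∞} (h : ∀ x, φ x ≤ c) (x : V) : G.killedStep s φ x ≤ c := by
  rw [killedStep]
  split_ifs
  · calc ∑' y, G.trans x y * φ y ≤ ∑' y, G.trans x y * c :=
          ENNReal.tsum_le_tsum fun y => mul_le_mul_right (h y) _
      _ = c := by rw [ENNReal.tsum_mul_right, tsum_trans, one_mul]
  · exact zero_le

theorem iterate_killedStep_le {c : ℝ≥0∞} (h : ∀ x, φ x ≤ c) (k : ℕ) (x : V) :
    (G.killedStep s)^[k] φ x ≤ c := by
  induction k generalizing x with
  | zero => exact h x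
  | succ k ih => rw [Function.iterate_succ_apply']; exact killedStep_le ih x

theorem resolvent_eq_add (x : V) :
    G.resolvent s r φ x = φ x + r * G.killedStep s (G.resolvent s r φ) x := by
  rw [resolvent, tsum_eq_zero_add' ENNReal.summable]
  congr 1
  · simp
  · simp only [Function.iterate_succ_apply', pow_succ', mul_assoc]
    rw [ENNReal.tsum_mul_left]
    congr 1
    simp only [killedStep]
    split_ifs
    · simp only [resolvent, ← ENNReal.tsum_mul_left]
      rw [ENNReal.tsum_comm]
      exact tsum_congr fun y => tsum_congr fun k => by ring
    · simp

theorem resolvent_of_notMem {x : V} (hx : x ∉ s) : G.resolvent s r φ x = φ x := by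
  rw [resolvent_eq_add, killedStep_of_notMem hx, mul_zero, add_zero]

theorem vw_mul_resolvent {x : V} (hx : x ∈ s) :
    G.vw x * G.resolvent s r φ x
      = G.vw x * φ x + r * ∑' y, G.w x y * G.resolvent s r φ y := by
  rw [resolvent_eq_add, mul_add, mul_left_comm, killedStep, if_pos hx, ← ENNReal.tsum_mul_left]
  simp only [← mul_assoc, vw_mul_trans]

theorem resolvent_lt_top {c : ℝ≥0∞} (hc : c ≠ ⊤) (h : ∀ x, φ x ≤ c) (hr : r < 1) (x : V) :
    G.resolvent s r φ x < ⊤ := by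
  refine lt_of_le_of_lt (ENNReal.tsum_le_tsum fun k =>
    mul_le_mul_right (iterate_killedStep_le h k x) _) ?_
  rw [ENNReal.tsum_mul_right, ENNReal.tsum_geometric]
  exact ENNReal.mul_lt_top (ENNReal.inv_lt_top.2 (tsub_pos_of_lt hr)) hc.lt_top

theorem resolvent_le_one (hs : ∀ x ∈ s, φ x = 0) (h : ∀ x, φ x ≤ 1) (hr : r ≤ 1) (x : V) :
    G.resolvent s r φ x ≤ 1 := by
  have key : ∀ n x, ∑ k ∈ Finset.range n, r ^ k * (G.killedStep s)^[k] φ x ≤ 1 := by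
    intro n
    induction n with
    | zero => simp
    | succ n ih =>
      intro x
      rw [Finset.sum_range_succ']
      by_cases hx : x ∈ s
      · have h1 : ∑ k ∈ Finset.range n, r ^ (k + 1) * (G.killedStep s)^[k + 1] φ x
            = r * G.killedStep s
              (fun y => ∑ k ∈ Finset.range n, r ^ k * (G.killedStep s)^[k] φ y) x := by
          simp only [Function.iterate_succ_apply', pow_succ', mul_assoc]
          rw [← Finset.mul_sum]
          congr 1
          simp only [killedStep, if_pos hx, ← ENNReal.tsum_mul_left, Finset.mul_sum]
          rw [Summable.tsum_finsetSum fun _ _ => ENNReal.summable]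
          exact Finset.sum_congr rfl fun k _ => tsum_congr fun y => by ring
        rw [h1]
        simp only [pow_zero, Function.iterate_zero, id, one_mul, hs x hx, add_zero]
        exact mul_le_one' hr (killedStep_le ih x)
      · rw [Finset.sum_eq_zero fun k _ => ?_]
        · simpa using h x
        · rw [Function.iterate_succ_apply', killedStep_of_notMem hx, mul_zero]
  rw [resolvent, ENNReal.tsum_eq_iSup_nat]
  exact iSup_le fun n => key n x

theorem tsum_path_eq_iterate_killedStep (k : ℕ) (a : V) :
    ∑' x : Fin (k + 1) → V, (if x 0 = a then 1 else 0) *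
        (∏ i : Fin k, if x i.castSucc ∈ s then G.trans (x i.castSucc) (x i.succ) else 0) *
        φ (x (Fin.last k))
      = (G.killedStep s)^[k] φ a := by
  induction k generalizing a with
  | zero =>
    rw [← (Equiv.funUnique (Fin 1) V).symm.tsum_eq]
    simp only [Equiv.funUnique_symm_apply, uniqueElim_const, Finset.univ_eq_empty,
      Finset.prod_empty, mul_one, Function.iterate_zero, id]
    rw [tsum_eq_single a fun b hb => by simp [hb]]
    simp
  | succ k ih =>
    rw [Function.iterate_succ_apply', ← (Fin.consEquiv fun _ => V).tsum_eq, ENNReal.tsum_prod',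
      tsum_eq_single a fun b hb => by simp [Fin.consEquiv, hb]]
    simp only [Fin.consEquiv, Equiv.coe_fn_mk, Fin.cons_zero, if_true, one_mul,
      Fin.prod_univ_succ, Fin.castSucc_zero, Fin.cons_succ, ← Fin.succ_last,
      ← Fin.succ_castSucc, killedStep]
    split_ifs with ha
    · simp only [← ih, ← ENNReal.tsum_mul_left]
      rw [ENNReal.tsum_comm]
      refine tsum_congr fun x => ?_
      rw [tsum_eq_single (x 0) fun b hb => by simp [hb.symm]]
      simp [mul_assoc]
    · simp

end WeightedGraph

section Walk

variable {V : Type*} [Countable V] [MeasurableSpace V]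
  {G : WeightedGraph V} {o : V} {μ : Measure (ℕ → V)}

theorem measure_exit_at_le (hμ : IsRandomWalk G o μ) (s z : Set V) (k : ℕ) :
    μ {ω | (∀ i < k, ω i ∈ s) ∧ ω k ∈ z}
      ≤ (G.killedStep s)^[k] (fun x => if x ∈ z then 1 else 0) o := by
  rw [← WeightedGraph.tsum_path_eq_iterate_killedStep]
  set Q : (Fin (k + 1) → V) → Prop := fun x => (∀ i : Fin k, x i.castSucc ∈ s) ∧ x (Fin.last k) ∈ z
  have hsub : {ω : ℕ → V | (∀ i < k, ω i ∈ s) ∧ ω k ∈ z}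
      ⊆ ⋃ x : Fin (k + 1) → V, {ω | Q x ∧ ∀ i : Fin (k + 1), ω (i : ℕ) = x i} := by
    rintro ω ⟨h1, h2⟩
    exact Set.mem_iUnion.2 ⟨fun i => ω i, ⟨fun i => h1 i i.2, h2⟩, fun i => rfl⟩
  refine (measure_mono hsub).trans ((measure_iUnion_le _).trans (ENNReal.tsum_le_tsum fun x => ?_))
  by_cases hQ : Q x
  · simp only [hQ, true_and, hμ.2 k x, if_pos hQ.2, mul_one]
    rw [Finset.prod_congr rfl fun i _ => if_pos (hQ.1 i)]
  · simp [hQ]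

theorem pow_mul_measure_exit_le (hμ : IsRandomWalk G o μ) (s z : Set V) (n : ℕ) {r : ℝ≥0∞}
    (hr : r ≤ 1) :
    r ^ n * μ {ω | ∃ k ≤ n, (∀ i < k, ω i ∈ s) ∧ ω k ∈ z}
      ≤ G.resolvent s r (fun x => if x ∈ z then 1 else 0) o := by
  have hsub : {ω : ℕ → V | ∃ k ≤ n, (∀ i < k, ω i ∈ s) ∧ ω k ∈ z}
      ⊆ ⋃ k ∈ Finset.range (n + 1), {ω | (∀ i < k, ω i ∈ s) ∧ ω k ∈ z} := by
    rintro ω ⟨k, hk, h⟩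
    exact Set.mem_biUnion (Finset.mem_coe.2 (Finset.mem_range.2 (Nat.lt_succ_of_le hk))) h
  calc r ^ n * μ {ω | ∃ k ≤ n, (∀ i < k, ω i ∈ s) ∧ ω k ∈ z}
      ≤ r ^ n * ∑ k ∈ Finset.range (n + 1), μ {ω | (∀ i < k, ω i ∈ s) ∧ ω k ∈ z} :=
        mul_le_mul_right ((measure_mono hsub).trans (measure_biUnion_finset_le _ _)) _
    _ ≤ ∑ k ∈ Finset.range (n + 1),
          r ^ k * (G.killedStep s)^[k] (fun x => if x ∈ z then 1 else 0) o := by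
        rw [Finset.mul_sum]
        refine Finset.sum_le_sum fun k hk => mul_le_mul' ?_ (measure_exit_at_le hμ s z k)
        exact pow_le_pow_right_of_le_one' hr (Nat.lt_succ_iff.1 (Finset.mem_range.1 hk))
    _ ≤ _ := ENNReal.sum_le_tsum _

end Walk

namespace WeightedGraph

variable {V : Type*} (G : WeightedGraph V)

theorem exists_nat_edist (o : V) (hconn : ∀ x, G.edist o x ≠ ⊤) :
    ∃ ρ : V → ℕ, (∀ x, G.edist o x = ρ x) ∧ ρ o = 0 ∧ ∀ x y, 0 < G.w x y → ρ y ≤ ρ x + 1 := by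
  set R : V → ℕ → Prop := fun x k =>
    ∃ p : ℕ → V, p 0 = o ∧ p k = x ∧ ∀ i, i < k → 0 < G.w (p i) (p (i + 1))
  have hR : ∀ x, ∃ k, R x k := by
    intro x
    by_contra! h
    refine hconn x ?_
    simp only [edist, iInf_eq_top]
    exact fun k hk => absurd hk (h k)
  refine ⟨fun x => Nat.find (hR x), fun x => le_antisymm ?_ ?_, ?_, fun x y hxy => ?_⟩
  · exact iInf₂_le (Nat.find (hR x)) (Nat.find_spec (hR x))
  · exact le_iInf₂ fun k hk => Nat.cast_le.2 (Nat.find_min' (hR x) hk)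
  · exact Nat.le_zero.1 (Nat.find_min' (hR o) ⟨fun _ => o, rfl, rfl, by simp⟩)
  · have hx := Nat.find_spec (hR x)
    show Nat.find (hR y) ≤ Nat.find (hR x) + 1
    generalize Nat.find (hR x) = k at hx ⊢
    obtain ⟨p, h0, hk, hp⟩ := hx
    refine Nat.find_min' (hR y) ⟨fun i => if i ≤ k then p i else y, by simpa using h0, by simp,
      fun i hi => ?_⟩
    rcases (Nat.lt_succ_iff.1 hi).lt_or_eq with h | h
    · simp only [if_pos h.le, if_pos (show i + 1 ≤ k from h)]
      exact hp i h
    · subst h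
      simpa [hk] using hxy

end WeightedGraph

section ExitBound

variable {V : Type*} [Countable V] [MeasurableSpace V]
  {G : WeightedGraph V} {o : V} {μ : Measure (ℕ → V)}

/-- Lower bound on the discounted exit cost for the walk killed outside a finite subset of a
ball of radius `d`. -/
theorem exists_discounted_exit_bound (hμ : IsRandomWalk G o μ) {ρ : V → ℕ}
    (hρ : ∀ x, G.edist o x = ρ x) (hρo : ρ o = 0) (hρ1 : ∀ x y, 0 < G.w x y → ρ y ≤ ρ x + 1)
    {d : ℕ} {K : ℝ} (hK0 : 0 ≤ K) (hK : G.boundaryWeight o d ≤ ENNReal.ofReal K)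
    (s : Finset V) (hs : ∀ x ∈ s, ρ x ≤ d) (hos : o ∈ s) (n : ℕ) {r : ℝ} (hr0 : 0 < r)
    (hr1 : r < 1)
    (hP : 0 < (μ {ω | ∃ k ≤ n, (∀ i < k, ω i ∈ s) ∧ ω k ∈ {x | d < ρ x}}).toReal) :
    ∃ t : ℝ, r ^ n * (μ {ω | ∃ k ≤ n, (∀ i < k, ω i ∈ s) ∧ ω k ∈ {x | d < ρ x}}).toReal ≤ t ∧
      t ≤ 1 ∧ 2 * -Real.log r * (d : ℝ) ^ 2
        ≤ -Real.log t * (-2 * Real.log t + Real.log (K / ((G.vw o).toReal * (1 - r)))) := by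
  set r' : ℝ≥0∞ := ENNReal.ofReal r with hr'
  have hr'1 : r' < 1 := ENNReal.ofReal_lt_one.2 hr1
  have hr'r : r'.toReal = r := ENNReal.toReal_ofReal hr0.le
  set z : Set V := {x | d < ρ x} with hz
  set F := G.resolvent (s : Set V) r' (fun x => if x ∈ z then 1 else 0) with hF
  set H := G.resolvent (s : Set V) r' (fun x => if x = o then (G.vw o)⁻¹ else 0) with hH
  set c : V → ℝ≥0∞ := fun x => ∑' y, if y ∈ z then G.w x y else 0 with hc
  have hsz : ∀ x ∈ s, x ∉ z := fun x hx => not_lt.2 (hs x hx)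
  have hF1 : ∀ x, F x ≤ 1 := fun x => by
    refine WeightedGraph.resolvent_le_one (fun x hx => if_neg (hsz x hx)) (fun x => ?_) hr'1.le x
    split_ifs <;> simp
  have hFtop : ∀ x, F x ≠ ⊤ := fun x => ((hF1 x).trans_lt ENNReal.one_lt_top).ne
  have hHtop : ∀ x, H x ≠ ⊤ := fun x => by
    refine (WeightedGraph.resolvent_lt_top (c := (G.vw o)⁻¹)
      (ENNReal.inv_ne_top.2 (G.vw_ne_zero o)) (fun x => ?_) hr'1 x).ne
    split_ifs <;> simp
  have hwle : ∀ x y, G.w x y ≤ G.vw x := fun x y => ENNReal.le_tsum y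
  have hwtop : ∀ x y, G.w x y ≠ ⊤ := fun x y => ((hwle x y).trans_lt (G.vw_lt_top x)).ne
  have hcle : ∀ x, c x ≤ G.vw x := fun x => ENNReal.tsum_le_tsum fun y => by
    split_ifs <;> simp
  have hctop : ∀ x, c x ≠ ⊤ := fun x => ((hcle x).trans_lt (G.vw_lt_top x)).ne
  have hsumite : ∀ g : V → ℝ≥0∞, ∑' y, (if y ∈ s then g y else 0) = ∑ y ∈ s, g y := fun g => by
    rw [tsum_eq_sum (s := s) fun y hy => if_neg hy]
    exact Finset.sum_congr rfl fun y hy => if_pos hy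
  have eF : ∀ x ∈ s, G.vw x * F x = r' * (∑ y ∈ s, G.w x y * F y + c x) := fun x hx => by
    rw [hF, WeightedGraph.vw_mul_resolvent (Finset.mem_coe.2 hx), if_neg (hsz x hx), mul_zero,
      zero_add, ← hsumite, hc, ← ENNReal.tsum_add]
    congr 1
    refine tsum_congr fun y => ?_
    by_cases hy : y ∈ s
    · simp [hy, hsz y hy]
    · rw [WeightedGraph.resolvent_of_notMem (by simpa using hy)]
      simp [hy]
  have eH : ∀ x ∈ s, G.vw x * H x
      = (if x = o then 1 else 0) + r' * ∑ y ∈ s, G.w x y * H y := fun x hx => by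
    rw [hH, WeightedGraph.vw_mul_resolvent (Finset.mem_coe.2 hx), ← hsumite]
    congr 1
    · split_ifs with h
      · rw [h]; exact ENNReal.mul_inv_cancel (G.vw_ne_zero o) (G.vw_ne_top o)
      · simp
    · congr 1
      refine tsum_congr fun y => ?_
      by_cases hy : y ∈ s
      · simp [hy]
      · rw [WeightedGraph.resolvent_of_notMem (by simpa using hy)]
        have : y ≠ o := fun h => hy (h ▸ hos)
        simp [hy, this]
  have hW : ∀ x, ∑ y ∈ s, G.w x y + c x ≤ G.vw x := fun x => by
    rw [← hsumite, hc, ← ENNReal.tsum_add]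
    refine ENNReal.tsum_le_tsum fun y => ?_
    by_cases hy : y ∈ s
    · simp [hy, hsz y hy]
    · simp only [hy, if_false, zero_add]
      split_ifs <;> simp
  have hcpos : ∀ x, c x ≠ 0 → d ≤ ρ x := fun x hx => by
    by_contra! h
    refine hx (ENNReal.tsum_eq_zero.2 fun y => ?_)
    split_ifs with hy
    · by_contra h0
      have := hρ1 x y (pos_iff_ne_zero.2 h0)
      have : d < ρ y := hy
      omega
    · rfl
  have hcsum : ∑ x ∈ s, c x ≤ ENNReal.ofReal K := by
    refine le_trans ?_ hK
    rw [WeightedGraph.boundaryWeight, ENNReal.tsum_prod']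
    refine le_trans (Finset.sum_le_sum fun x hx => ?_) (ENNReal.sum_le_tsum s)
    refine ENNReal.tsum_le_tsum fun y => ?_
    split_ifs with h1 h2
    · exact le_rfl
    · by_contra! h0
      have h3 := hρ1 x y h0
      have h4 : d < ρ y := h1
      have h5 := hs x hx
      refine h2 ?_
      simp only [hρ]
      rw [min_eq_left (Nat.cast_le.2 (by omega)), show ρ x = d by omega]
    · exact zero_le
    · exact le_rfl
  have hbound : r' ^ n * μ {ω | ∃ k ≤ n, (∀ i < k, ω i ∈ s) ∧ ω k ∈ z} ≤ F o := by
    convert pow_mul_measure_exit_le hμ (s : Set V) z n hr'1.le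
    exact Finset.mem_coe.symm
  have hboundR : r ^ n * (μ {ω | ∃ k ≤ n, (∀ i < k, ω i ∈ s) ∧ ω k ∈ z}).toReal
      ≤ (F o).toReal := by
    have := ENNReal.toReal_mono (hFtop o) hbound
    rwa [ENNReal.toReal_mul, ENNReal.toReal_pow, hr'r] at this
  refine ⟨(F o).toReal, hboundR, ?_, ?_⟩
  · simpa using ENNReal.toReal_mono ENNReal.one_ne_top (hF1 o)
  refine exit_distance_bound (ι := s) (o := ⟨o, hos⟩) (w := fun x y => (G.w x y).toReal)
    (c := fun x => (c x).toReal) (W := fun x => (G.vw x).toReal) (h := fun x => (H x).toReal)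
    (f := fun x => (F x).toReal) (ρ := fun x => (ρ x : ℝ)) (D := (d : ℝ)) (K := K)
    (fun x y => by rw [G.symm]) (fun _ _ => ENNReal.toReal_nonneg)
    (fun _ => ENNReal.toReal_nonneg)
    (fun x => ENNReal.toReal_pos (G.vw_ne_zero x) (G.vw_ne_top x)) (fun x => ?_) hr0 hr1
    (fun _ => ENNReal.toReal_nonneg) (fun _ => ENNReal.toReal_nonneg) (fun x => ?_)
    (fun x => ?_) (fun x => ?_) ?_ (by simpa using hρo) (fun x y hxy => ?_) (fun x hx => ?_)
    (Nat.cast_nonneg d) ?_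
  · rw [Finset.sum_coe_sort s fun y => (G.w x y).toReal, ← ENNReal.toReal_sum fun y _ => hwtop x y,
      ← ENNReal.toReal_add (ENNReal.sum_ne_top.2 fun y _ => hwtop x y) (hctop x)]
    exact ENNReal.toReal_mono (G.vw_ne_top x) (hW x)
  · simpa using ENNReal.toReal_mono ENNReal.one_ne_top (hF1 x)
  · have hm : ∀ y ∈ s, G.w x y * H y ≠ ⊤ := fun y _ => ENNReal.mul_ne_top (hwtop x y) (hHtop y)
    have := congrArg ENNReal.toReal (eH x x.2)
    rw [ENNReal.toReal_add (by split_ifs <;> simp) (ENNReal.mul_ne_top ENNReal.ofReal_ne_top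
      (ENNReal.sum_ne_top.2 hm)), ENNReal.toReal_mul, ENNReal.toReal_mul, ENNReal.toReal_sum hm,
      hr'r] at this
    simp only [ENNReal.toReal_mul] at this
    rw [this, Finset.sum_coe_sort s fun y => (G.w x y).toReal * (H y).toReal]
    congr 1
    simp only [Subtype.ext_iff]
    split_ifs <;> simp
  · have hm : ∀ y ∈ s, G.w x y * F y ≠ ⊤ := fun y _ => ENNReal.mul_ne_top (hwtop x y) (hFtop y)
    have := congrArg ENNReal.toReal (eF x x.2)
    rw [ENNReal.toReal_mul, ENNReal.toReal_mul, ENNReal.toReal_add (ENNReal.sum_ne_top.2 hm)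
      (hctop x), ENNReal.toReal_sum hm, hr'r] at this
    simp only [ENNReal.toReal_mul] at this
    rw [this, Finset.sum_coe_sort s fun y => (G.w x y).toReal * (F y).toReal]
  · exact lt_of_lt_of_le (by positivity) hboundR
  · have h1 : 0 < G.w x y := (ENNReal.toReal_pos_iff.1 hxy).1
    have h2 : (ρ y : ℝ) ≤ ρ x + 1 := by exact_mod_cast hρ1 x y h1
    have h3 : (ρ x : ℝ) ≤ ρ y + 1 := by exact_mod_cast hρ1 y x (by rwa [G.symm])
    rw [abs_le]
    constructor <;> linarith
  · exact Nat.cast_le.2 (hcpos x (ENNReal.toReal_pos_iff.1 hx).1.ne')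
  · rw [Finset.sum_coe_sort s fun x => (c x).toReal, ← ENNReal.toReal_sum fun x _ => hctop x]
    exact ENNReal.toReal_le_of_le_ofReal hK0 hcsum

/-- Criterion bounding the probability that the walk leaves the ball of radius `d` by time `n`. -/
theorem measure_exists_lt_le (hμ : IsRandomWalk G o μ) {ρ : V → ℕ}
    (hρ : ∀ x, G.edist o x = ρ x) (hρo : ρ o = 0) (hρ1 : ∀ x y, 0 < G.w x y → ρ y ≤ ρ x + 1)
    {d : ℕ} {K : ℝ} (hK0 : 0 ≤ K) (hK : G.boundaryWeight o d ≤ ENNReal.ofReal K)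
    (n : ℕ) {r δ : ℝ} (hr0 : 0 < r) (hr1 : r < 1) (hδ : 0 ≤ δ)
    (hbound : ∀ t : ℝ, r ^ n * δ < t → t ≤ 1 →
      -Real.log t * (-2 * Real.log t + Real.log (K / ((G.vw o).toReal * (1 - r))))
        < 2 * -Real.log r * (d : ℝ) ^ 2) :
    μ {ω | ∃ k ≤ n, d < ρ (ω k)} ≤ ENNReal.ofReal δ := by
  have := hμ.1
  set ball : Finset V → Finset V := fun s => insert o (s.filter fun x => ρ x ≤ d)
  set E : Finset V → Set (ℕ → V) :=
    fun s => {ω | ∃ k ≤ n, (∀ i < k, ω i ∈ ball s) ∧ ω k ∈ {x | d < ρ x}}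
  have hE : ∀ s, μ (E s) ≤ ENNReal.ofReal δ := by
    intro s
    by_contra! h
    have hlt : δ < (μ (E s)).toReal := (ENNReal.ofReal_lt_iff_lt_toReal hδ (measure_ne_top _ _)).1 h
    obtain ⟨t, ht, ht1, hle⟩ := exists_discounted_exit_bound hμ hρ hρo hρ1 hK0 hK (ball s)
      (fun x hx => by
        rcases Finset.mem_insert.1 hx with rfl | hx
        · omega
        · exact (Finset.mem_filter.1 hx).2)
      (Finset.mem_insert_self _ _) n hr0 hr1 (hδ.trans_lt hlt)
    exact absurd hle (not_le.2 (hbound t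
      ((mul_lt_mul_of_pos_left hlt (pow_pos hr0 n)).trans_le ht) ht1))
  have hmono : Monotone E := by
    rintro s t hst ω ⟨k, hk, h1, h2⟩
    exact ⟨k, hk, fun i hi => Finset.insert_subset_insert o
      (Finset.filter_subset_filter _ hst) (h1 i hi), h2⟩
  have hsub : {ω : ℕ → V | ∃ k ≤ n, d < ρ (ω k)} ⊆ ⋃ s, E s := by
    intro ω hω
    have hω' : ∃ k, d < ρ (ω k) := hω.imp fun k hk => hk.2
    obtain ⟨k, hk, hdk⟩ := hω
    refine Set.mem_iUnion.2 ⟨(Finset.range (Nat.find hω')).image ω, Nat.find hω',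
      (Nat.find_min' hω' hdk).trans hk, fun i hi => ?_, Nat.find_spec hω'⟩
    exact Finset.mem_insert_of_mem (Finset.mem_filter.2
      ⟨Finset.mem_image_of_mem _ (Finset.mem_range.2 hi), not_lt.1 (Nat.find_min hω' hi)⟩)
  refine (measure_mono hsub).trans ?_
  rw [hmono.directed_le.measure_iUnion]
  exact iSup_le hE

end ExitBound

section PolynomialGrowth

variable {V : Type*} [Countable V] [MeasurableSpace V]
  {G : WeightedGraph V} {o : V} {μ : Measure (ℕ → V)}

theorem eventually_add_mul_log_log_le (b c : ℝ) {κ : ℝ} (hκ : 0 < κ) (hc : 0 ≤ c) :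
    ∀ᶠ t : ℝ in atTop, b + c * Real.log (Real.log t) ≤ κ * Real.log t := by
  have h1 : ∀ᶠ u : ℝ in atTop, b + c * Real.log u ≤ κ * u := by
    have h2 := Real.isLittleO_log_id_atTop.bound (c := κ / (2 * (c + 1))) (by positivity)
    filter_upwards [h2, eventually_ge_atTop (2 * b / κ), eventually_ge_atTop 0] with u hu hb h0
    rw [Real.norm_eq_abs, Real.norm_eq_abs, id, abs_of_nonneg h0] at hu
    have h3 : c * Real.log u ≤ c * (κ / (2 * (c + 1)) * u) :=
      mul_le_mul_of_nonneg_left ((le_abs_self _).trans hu) hc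
    have h4 : c * (κ / (2 * (c + 1)) * u) = κ * u / 2 * (c / (c + 1)) := by field_simp
    have h5 : c / (c + 1) ≤ 1 := by rw [div_le_one (by linarith)]; linarith
    have h6 : κ * u / 2 * (c / (c + 1)) ≤ κ * u / 2 :=
      mul_le_of_le_one_right (by positivity) h5
    rw [div_le_iff₀ hκ] at hb
    linarith
  exact Real.tendsto_log_atTop.eventually h1

theorem exists_exponents {p c : ℝ} (hp : 0 ≤ p) (hc : (p + 2) / 4 < c) :
    ∃ κ : ℝ, 0 < κ ∧ ∃ α : ℝ, 0 < α ∧ ∃ ε : ℝ, 0 < ε ∧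
      (α + ε) * (2 * (α + ε) + (p / 2 + 1 + κ)) < 2 * α * c := by
  obtain ⟨κ, hκ⟩ : ∃ κ, κ = c - (p + 2) / 4 := ⟨_, rfl⟩
  obtain ⟨q, hq⟩ : ∃ q, q = p / 2 + 1 + κ := ⟨_, rfl⟩
  have hκ0 : 0 < κ := by linarith
  have hq0 : 0 < q := by linarith
  have hcq : 2 * c = q + κ := by linarith
  obtain ⟨θ, hθ⟩ : ∃ θ, θ = κ / (4 * (q + κ)) := ⟨_, rfl⟩
  have hθ0 : 0 < θ := by rw [hθ]; positivity
  have hθ1 : θ ≤ 1 := by rw [hθ, div_le_one (by positivity)]; linarith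
  have hθq : θ * q ≤ κ / 4 := by
    rw [hθ, div_mul_eq_mul_div, div_le_iff₀ (by positivity)]
    nlinarith [mul_pos hκ0 hκ0]
  refine ⟨κ, hκ0, κ / 16, by positivity, θ * (κ / 16), by positivity, ?_⟩
  rw [← hq]
  have h1 : (1 + θ) * (1 + θ) ≤ 4 := by nlinarith
  have h2 : κ / 8 * ((1 + θ) * (1 + θ)) ≤ κ / 8 * 4 :=
    mul_le_mul_of_nonneg_left h1 (by positivity)
  calc (κ / 16 + θ * (κ / 16)) * (2 * (κ / 16 + θ * (κ / 16)) + q)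
      = κ / 16 * (κ / 8 * ((1 + θ) * (1 + θ)) + (q + θ * q)) := by ring
    _ < κ / 16 * (2 * c) := mul_lt_mul_of_pos_left (by linarith) (by positivity)
    _ = 2 * (κ / 16) * c := by ring

/-- Logarithmic size of the error term in the exit bound at radius `d ≤ a √(t log t)`. -/
theorem log_exit_error_le {p C W a t α d : ℝ} (hp : 0 ≤ p) (hC : 0 < C) (hW : 0 < W)
    (ha : 0 < a) (hα : 0 < α) (ht : 0 < t) (hlog : 1 ≤ Real.log t) (hd : 0 < d)
    (hda : d ≤ a * √(t * Real.log t)) (hle : α * Real.log t / t ≤ 1) :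
    Real.log (C * d ^ p / (W * (1 - Real.exp (-(α * Real.log t / t))))) ≤
      (p / 2 + 1) * Real.log t + (Real.log C + p * Real.log a - Real.log W + Real.log 2
        - Real.log α + p / 2 * Real.log (Real.log t)) := by
  have hl0 : 0 < Real.log t := by linarith
  obtain ⟨lam, hlam⟩ : ∃ lam, lam = α * Real.log t / t := ⟨_, rfl⟩
  rw [← hlam] at hle ⊢
  have hlam0 : 0 < lam := by rw [hlam]; positivity
  have hr1 : Real.exp (-lam) < 1 := Real.exp_lt_one_iff.2 (by linarith)
  have h1r : lam / 2 ≤ 1 - Real.exp (-lam) := by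
    have h1 : Real.exp (-lam) ≤ 1 / (1 + lam) := by
      rw [Real.exp_neg, ← one_div]
      exact one_div_le_one_div_of_le (by positivity) (by linarith [Real.add_one_le_exp lam])
    have h2 : 1 / (1 + lam) ≤ 1 - lam / 2 := by
      rw [div_le_iff₀ (by positivity)]; nlinarith
    linarith
  have h1 : Real.log lam - Real.log 2 ≤ Real.log (1 - Real.exp (-lam)) := by
    rw [← Real.log_div hlam0.ne' two_ne_zero]
    exact Real.log_le_log (by positivity) h1r
  have h2 : Real.log lam = Real.log α + Real.log (Real.log t) - Real.log t := by
    rw [hlam, Real.log_div (by positivity) ht.ne', Real.log_mul hα.ne' hl0.ne']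
  have h3 : Real.log d ≤ Real.log a + (Real.log t + Real.log (Real.log t)) / 2 := by
    refine (Real.log_le_log hd hda).trans_eq ?_
    rw [Real.log_mul ha.ne' (Real.sqrt_pos.2 (by positivity)).ne', Real.log_sqrt (by positivity),
      Real.log_mul ht.ne' hl0.ne']
  have h4 : 0 ≤ Real.log (Real.log t) := Real.log_nonneg hlog
  rw [Real.log_div (by positivity) (mul_pos hW (by linarith)).ne',
    Real.log_mul hC.ne' (by positivity), Real.log_rpow hd,
    Real.log_mul hW.ne' (by linarith)]
  have h5 := mul_le_mul_of_nonneg_left h3 hp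
  linarith

/-- Polynomial decay of the probability of leaving the ball of radius `a √(t log t)` by time
`t`. -/
theorem exists_eventually_measure_le (hμ : IsRandomWalk G o μ) {ρ : V → ℕ}
    (hρ : ∀ x, G.edist o x = ρ x) (hρo : ρ o = 0) (hρ1 : ∀ x y, 0 < G.w x y → ρ y ≤ ρ x + 1)
    {p C : ℝ} (hp : 0 ≤ p) (hC : 0 < C)
    (hgrowth : ∀ n : ℕ, 1 ≤ n → G.boundaryWeight o n ≤ ENNReal.ofReal (C * (n : ℝ) ^ p))
    {a : ℝ} (ha : √(p + 2) / 2 < a) :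
    ∃ ε > (0 : ℝ), ∀ᶠ t : ℝ in atTop,
      μ {ω | ∃ k ≤ ⌊t⌋₊, ⌊a * √(t * Real.log t)⌋₊ < ρ (ω k)} ≤ ENNReal.ofReal (t ^ (-ε)) := by
  obtain ⟨a₁, ha₁, ha₁a⟩ := exists_between ha
  have ha₁0 : 0 < a₁ := lt_of_le_of_lt (by positivity) ha₁
  have ha0 : 0 < a := ha₁0.trans ha₁a
  have hsq : (p + 2) / 4 < a₁ ^ 2 := by
    have h1 : (√(p + 2) / 2) ^ 2 < a₁ ^ 2 := pow_lt_pow_left₀ ha₁ (by positivity) two_ne_zero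
    rwa [div_pow, Real.sq_sqrt (by linarith), show (2 : ℝ) ^ 2 = 4 by norm_num] at h1
  obtain ⟨κ, hκ, α, hα0, ε, hε, hparam⟩ := exists_exponents hp hsq
  set W := (G.vw o).toReal with hW
  have hW0 : 0 < W := ENNReal.toReal_pos (G.vw_ne_zero o) (G.vw_ne_top o)
  refine ⟨ε, hε, ?_⟩
  filter_upwards [eventually_ge_atTop (Real.exp 1), Real.tendsto_log_atTop.eventually_ge_atTop 1,
    eventually_ge_atTop (1 / (a - a₁) ^ 2),
    (Real.isLittleO_log_id_atTop.bound (c := 1 / α) (by positivity)),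
    eventually_add_mul_log_log_le (Real.log C + p * Real.log a - Real.log W + Real.log 2
      - Real.log α) (p / 2) hκ (by positivity)] with t hte hlog htA htα hll
  have ht0 : 0 < t := (Real.exp_pos 1).trans_le hte
  have hl0 : 0 < Real.log t := by linarith
  set R := √(t * Real.log t) with hR
  have hR2 : R ^ 2 = t * Real.log t := Real.sq_sqrt (by positivity)
  have hRpos : 0 < R := Real.sqrt_pos.2 (by positivity)
  set d := ⌊a * R⌋₊ with hd
  have hda : (d : ℝ) ≤ a * R := Nat.floor_le (by positivity)
  have hda₁ : a₁ * R ≤ d := by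
    have h1 : a * R < d + 1 := Nat.lt_floor_add_one _
    have h2 : 1 ≤ (a - a₁) * R := by
      have h3 : 0 < a - a₁ := sub_pos.2 ha₁a
      rw [div_le_iff₀ (by positivity)] at htA
      have h4 : 1 ≤ ((a - a₁) * R) ^ 2 := by rw [mul_pow, hR2]; nlinarith
      by_contra! h5
      have h6 : 0 < (a - a₁) * R := by positivity
      nlinarith
    linarith
  have hd0 : (0 : ℝ) < d := lt_of_lt_of_le (by positivity) hda₁
  have hd1 : 1 ≤ d := Nat.cast_pos.1 hd0
  set lam := α * Real.log t / t with hlam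
  have hlam0 : 0 < lam := by positivity
  have hlam1 : lam ≤ 1 := by
    rw [Real.norm_eq_abs, Real.norm_eq_abs, id, abs_of_nonneg hl0.le, abs_of_nonneg ht0.le,
      one_div_mul_eq_div, le_div_iff₀ hα0] at htα
    rw [hlam, div_le_one ht0]
    linarith
  have hr1 : Real.exp (-lam) < 1 := Real.exp_lt_one_iff.2 (by linarith)
  refine measure_exists_lt_le hμ hρ hρo hρ1 (by positivity) (hgrowth d hd1) ⌊t⌋₊
    (Real.exp_pos (-lam)) hr1 (Real.rpow_nonneg ht0.le _) fun s hs hs1 => ?_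
  have hrn : t ^ (-α) ≤ Real.exp (-lam) ^ ⌊t⌋₊ := by
    rw [← Real.exp_nat_mul, Real.rpow_def_of_pos ht0, Real.exp_le_exp]
    have h1 : (⌊t⌋₊ : ℝ) * lam ≤ t * lam :=
      mul_le_mul_of_nonneg_right (Nat.floor_le ht0.le) hlam0.le
    have h2 : t * lam = α * Real.log t := by rw [hlam]; field_simp
    linarith
  have hs0 : t ^ (-(α + ε)) < s := by
    refine lt_of_le_of_lt ?_ hs
    rw [neg_add, Real.rpow_add ht0]
    exact mul_le_mul_of_nonneg_right hrn (Real.rpow_nonneg ht0.le _)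
  have hspos : 0 < s := (Real.rpow_pos_of_pos ht0 _).trans hs0
  have hA : -Real.log s ≤ (α + ε) * Real.log t := by
    have := Real.log_lt_log (Real.rpow_pos_of_pos ht0 _) hs0
    rw [Real.log_rpow ht0] at this
    linarith
  have hA0 : 0 ≤ -Real.log s := neg_nonneg.2 (Real.log_nonpos hspos.le hs1)
  have hL : Real.log (C * (d : ℝ) ^ p / (W * (1 - Real.exp (-lam)))) ≤
      (p / 2 + 1 + κ) * Real.log t := by
    have h1 := log_exit_error_le hp hC hW0 ha0 hα0 ht0 hlog hd0 hda hlam1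
    linarith
  rw [Real.log_exp, neg_neg]
  calc -Real.log s * (-2 * Real.log s + Real.log (C * (d : ℝ) ^ p / (W * (1 - Real.exp (-lam)))))
      ≤ -Real.log s * ((2 * (α + ε) + (p / 2 + 1 + κ)) * Real.log t) :=
        mul_le_mul_of_nonneg_left (by linarith) hA0
    _ ≤ (α + ε) * Real.log t * ((2 * (α + ε) + (p / 2 + 1 + κ)) * Real.log t) :=
        mul_le_mul_of_nonneg_right hA (by positivity)
    _ = (α + ε) * (2 * (α + ε) + (p / 2 + 1 + κ)) * Real.log t ^ 2 := by ring
    _ < 2 * α * a₁ ^ 2 * Real.log t ^ 2 := mul_lt_mul_of_pos_right hparam (by positivity)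
    _ = 2 * lam * (a₁ * R) ^ 2 := by rw [mul_pow, hR2, hlam]; field_simp
    _ ≤ 2 * lam * (d : ℝ) ^ 2 := by gcongr

theorem ae_eventually_ratio_le (hμ : IsRandomWalk G o μ) {ρ : V → ℕ}
    (hρ : ∀ x, G.edist o x = ρ x) (hρo : ρ o = 0) (hρ1 : ∀ x y, 0 < G.w x y → ρ y ≤ ρ x + 1)
    {p C : ℝ} (hp : 0 ≤ p) (hC : 0 < C)
    (hgrowth : ∀ n : ℕ, 1 ≤ n → G.boundaryWeight o n ≤ ENNReal.ofReal (C * (n : ℝ) ^ p))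
    {b : ℝ} (hb : √(p + 2) / 2 < b) :
    ∀ᵐ ω ∂μ, ∀ᶠ k : ℕ in atTop, (ρ (ω k) : ℝ) / √(k * Real.log k) ≤ b := by
  obtain ⟨a, ha, hab⟩ := exists_between hb
  have ha0 : 0 < a := lt_of_le_of_lt (by positivity) ha
  set q := b / a with hq
  have hq1 : 1 < q := (one_lt_div ha0).2 hab
  have hq0 : 0 < q := by linarith
  obtain ⟨ε, hε, hev⟩ := exists_eventually_measure_le hμ hρ hρo hρ1 hp hC hgrowth ha
  obtain ⟨N, hN⟩ := eventually_atTop.1 ((tendsto_pow_atTop_atTop_of_one_lt hq1).eventually hev)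
  have hsum : ∑' j : ℕ, μ {ω | ∃ k ≤ ⌊q ^ (j + N)⌋₊,
      ⌊a * √(q ^ (j + N) * Real.log (q ^ (j + N)))⌋₊ < ρ (ω k)} ≠ ⊤ := by
    have hg0 : 0 ≤ q ^ (-ε) := Real.rpow_nonneg hq0.le _
    have hg1 : q ^ (-ε) < 1 := Real.rpow_lt_one_of_one_lt_of_neg hq1 (neg_lt_zero.2 hε)
    refine ne_top_of_le_ne_top ?_ (ENNReal.tsum_le_tsum fun j => hN (j + N) (Nat.le_add_left N j))
    have hs : Summable fun j : ℕ => (q ^ (j + N)) ^ (-ε) := by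
      have h1 : Summable fun j : ℕ => (q ^ (-ε)) ^ (j + N) :=
        (summable_nat_add_iff N).2 (summable_geometric_of_lt_one hg0 hg1)
      refine h1.congr fun j => ?_
      rw [← Real.rpow_natCast, ← Real.rpow_natCast, ← Real.rpow_mul hq0.le,
        ← Real.rpow_mul hq0.le, mul_comm]
    exact hs.tsum_ofReal_ne_top
  filter_upwards [ae_eventually_notMem hsum] with ω hω
  obtain ⟨J, hJ⟩ := eventually_atTop.1 hω
  filter_upwards [(tendsto_natCast_atTop_atTop (R := ℝ)).eventually_ge_atTop (q ^ (J + N)),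
    (Real.tendsto_log_atTop.comp (tendsto_natCast_atTop_atTop (R := ℝ))).eventually_ge_atTop
      (Real.log q / (q - 1)), eventually_ge_atTop 2] with k hk hlog hk2
  have hk2' : (2 : ℝ) ≤ k := by exact_mod_cast hk2
  have hk0 : (0 : ℝ) < k := by linarith
  have hlk : 0 < Real.log k := Real.log_pos (by linarith)
  obtain ⟨n, hn, hn'⟩ := exists_nat_pow_near (show (1 : ℝ) ≤ k by linarith) hq1
  have hJn : J + N < n + 1 := (pow_lt_pow_iff_right₀ hq1).1 (hk.trans_lt hn')
  have h1 := hJ (n + 1 - N) (by omega)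
  rw [Nat.sub_add_cancel (by omega)] at h1
  simp only [not_exists, not_and, not_lt] at h1
  have h2 := h1 k (Nat.le_floor hn'.le)
  have hqk : q ^ (n + 1) ≤ q * k := by
    rw [pow_succ']; exact mul_le_mul_of_nonneg_left hn hq0.le
  have h3 : (ρ (ω k) : ℝ) ≤ a * √(q ^ (n + 1) * Real.log (q ^ (n + 1))) :=
    (Nat.cast_le.2 h2).trans (Nat.floor_le (by positivity))
  have h4 : Real.log (q ^ (n + 1)) ≤ q * Real.log k := by
    refine (Real.log_le_log (by positivity) hqk).trans ?_
    rw [Real.log_mul hq0.ne' hk0.ne']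
    rw [Function.comp, div_le_iff₀ (by linarith)] at hlog
    linarith
  have h5 : √(q ^ (n + 1) * Real.log (q ^ (n + 1))) ≤ q * √(k * Real.log k) := by
    refine Real.sqrt_le_iff.2 ⟨by positivity, ?_⟩
    rw [mul_pow, Real.sq_sqrt (by positivity)]
    calc q ^ (n + 1) * Real.log (q ^ (n + 1)) ≤ (q * k) * (q * Real.log k) :=
          mul_le_mul hqk h4 (Real.log_nonneg (one_le_pow₀ hq1.le)) (by positivity)
      _ = _ := by ring
  rw [div_le_iff₀ (Real.sqrt_pos.2 (by positivity))]
  calc (ρ (ω k) : ℝ) ≤ a * (q * √(k * Real.log k)) :=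
        h3.trans (mul_le_mul_of_nonneg_left h5 ha0.le)
    _ = b * √(k * Real.log k) := by rw [hq]; field_simp

end PolynomialGrowth

/-- Law of the single logarithm, upper bound: on an infinite connected
weighted graph with polynomial boundary growth `wₙ ≤ C n^p`, the random walk satisfies
`limsup |X_k|/√(k log k) ≤ √(p+2)/2` almost surely. -/
theorem law_of_single_logarithm_upper_bound
    {V : Type*} [Countable V] [Infinite V] [MeasurableSpace V] [MeasurableSingletonClass V]
    (p C : ℝ) (hp : 0 ≤ p) (hC : 0 < C)
    (G : WeightedGraph V) (o : V) (hconn : ∀ x, G.edist o x ≠ ⊤)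
    (hgrowth : ∀ n : ℕ, 1 ≤ n → G.boundaryWeight o n ≤ ENNReal.ofReal (C * (n : ℝ) ^ p))
    (μ : Measure (ℕ → V)) (hμ : IsRandomWalk G o μ) :
    ∀ᵐ ω ∂μ,
      Filter.limsup
          (fun k : ℕ => (G.edist o (ω k)).toReal / Real.sqrt (k * Real.log k)) atTop
        ≤ Real.sqrt (p + 2) / 2 := by
  obtain ⟨ρ, hρ, hρo, hρ1⟩ := G.exists_nat_edist o hconn
  have hae : ∀ᵐ ω ∂μ, ∀ m : ℕ, ∀ᶠ k : ℕ in atTop,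
      (ρ (ω k) : ℝ) / √(k * Real.log k) ≤ √(p + 2) / 2 + 1 / ((m : ℝ) + 1) :=
    ae_all_iff.2 fun m => ae_eventually_ratio_le hμ hρ hρo hρ1 hp hC hgrowth
      (lt_add_of_pos_right _ Nat.one_div_pos_of_nat)
  filter_upwards [hae] with ω hω
  simp only [hρ, ENNReal.toReal_natCast]
  have hcob : IsCoboundedUnder (· ≤ ·) atTop
      fun k : ℕ => (ρ (ω k) : ℝ) / √(k * Real.log k) :=
    IsBoundedUnder.isCoboundedUnder_le (isBoundedUnder_of ⟨0, fun k => by positivity⟩)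
  have hlim : Tendsto (fun m : ℕ => √(p + 2) / 2 + 1 / ((m : ℝ) + 1)) atTop
      (nhds (√(p + 2) / 2 + 0)) :=
    tendsto_const_nhds.add tendsto_one_div_add_atTop_nhds_zero_nat
  rw [add_zero] at hlim
  exact ge_of_tendsto' hlim fun m => limsup_le_of_le hcob (hω m)

end RWHitting
end

section
/- Let β ∈ (0,1), let m ≥ 1 be an integer, and let α₁, α₂, c₁, c₂ > 0. Define h(s) := s(1 − sβ)/(β − s) for s ∈ [0,β). Suppose (x₁, y₁, x₂, y₂) ∈ [0,β)⁴ achieves the minimum of α₁ h(x₁) h(y₁)^m + α₂ h(x₂) h(y₂)^m over all points of [0,β)⁴ satisfying the constraints α₁ x₁ y₁^m + α₂ x₂ y₂^m = c₁ and α₁ x₁ + α₂ x₂ ≤ c₂. Then x₁ = x₂ and y₁ = y₂. -/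
open MeasureTheory Filter
open scoped Classical ENNReal

namespace RWHitting

variable {V : Type*}

/-- The ratio `h(s) / s`. -/
noncomputable def gain (β s : ℝ) : ℝ := (1 - s * β) / (β - s)

/-- The logarithmic derivative `s g'(s) / g(s)` of `g = gain β`. -/
noncomputable def gainSlope (β s : ℝ) : ℝ := s * (1 - β ^ 2) / ((1 - s * β) * (β - s))

section Gain

variable {β : ℝ}

lemma one_sub_mul_pos (hβ : β ∈ Set.Ioo (0 : ℝ) 1) {s : ℝ} (hs : s < β) : 0 < 1 - s * β := by
  nlinarith [hβ.1, hβ.2]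

lemma gain_pos (hβ : β ∈ Set.Ioo (0 : ℝ) 1) {s : ℝ} (hs : s < β) : 0 < gain β s :=
  div_pos (one_sub_mul_pos hβ hs) (sub_pos.2 hs)

lemma gainSlope_pos (hβ : β ∈ Set.Ioo (0 : ℝ) 1) {s : ℝ} (hs : s ∈ Set.Ioo 0 β) :
    0 < gainSlope β s := by
  have h1 := one_sub_mul_pos hβ hs.2
  have h2 := sub_pos.2 hs.2
  have h3 : 0 < 1 - β ^ 2 := by nlinarith [hβ.1, hβ.2]
  have h4 := hs.1
  unfold gainSlope
  positivity

lemma strictMonoOn_gainSlope (hβ : β ∈ Set.Ioo (0 : ℝ) 1) :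
    StrictMonoOn (gainSlope β) (Set.Ioo 0 β) := by
  intro s hs t ht hst
  have h1 := one_sub_mul_pos hβ hs.2
  have h2 := sub_pos.2 hs.2
  have h3 : 0 < 1 - β ^ 2 := by nlinarith [hβ.1, hβ.2]
  have h4 := one_sub_mul_pos hβ ht.2
  have h5 := sub_pos.2 ht.2
  have h6 : (1 - t * β) * (β - t) < (1 - s * β) * (β - s) :=
    mul_lt_mul'' (by nlinarith [hβ.1]) (by linarith) h4.le h5.le
  exact div_lt_div₀ (mul_lt_mul_of_pos_right hst h3) h6.le
    (mul_nonneg ht.1.le h3.le) (by positivity)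

lemma hasDerivAt_log_gain (hβ : β ∈ Set.Ioo (0 : ℝ) 1) {s : ℝ} (hs : s ∈ Set.Ioo 0 β) (a : ℝ) :
    HasDerivAt (fun s => Real.log (1 - s * β) - Real.log (β - s) - a * Real.log s)
      ((gainSlope β s - a) / s) s := by
  have h1 := one_sub_mul_pos hβ hs.2
  have h2 := sub_pos.2 hs.2
  have h4 := hs.1
  have d1 := (((hasDerivAt_id s).mul_const β).const_sub 1).log h1.ne'
  have d2 := ((hasDerivAt_id s).const_sub β).log h2.ne'
  have d3 := (Real.hasDerivAt_log h4.ne').const_mul a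
  refine ((d1.sub d2).sub d3).congr_deriv ?_
  simp only [id, gainSlope]
  have : 1 - β * s ≠ 0 := by rw [mul_comm]; exact h1.ne'
  have := h2.ne'
  field_simp
  ring

/-- In logarithmic coordinates `gain β` lies strictly above its tangents. -/
lemma gainSlope_mul_lt_log_gain (hβ : β ∈ Set.Ioo (0 : ℝ) 1) {s t : ℝ}
    (hs : s ∈ Set.Ioo 0 β) (ht : t ∈ Set.Ioo 0 β) (hst : s ≠ t) :
    gainSlope β t * (Real.log s - Real.log t)
      < Real.log (gain β s) - Real.log (gain β t) := by
  set a := gainSlope β t with ha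
  set f : ℝ → ℝ := fun s => Real.log (1 - s * β) - Real.log (β - s) - a * Real.log s with hf
  have key : f t < f s := by
    rcases lt_or_gt_of_ne hst with hlt | hlt
    · have hsub : Set.Icc s t ⊆ Set.Ioo 0 β := fun r hr =>
        ⟨hs.1.trans_le hr.1, hr.2.trans_lt ht.2⟩
      refine strictAntiOn_of_deriv_neg (convex_Icc s t)
        (fun r hr => (hasDerivAt_log_gain hβ (hsub hr) a).continuousAt.continuousWithinAt)
        (fun r hr => ?_) (Set.left_mem_Icc.2 hlt.le) (Set.right_mem_Icc.2 hlt.le) hlt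
      rw [interior_Icc] at hr
      have hr' := hsub (Set.Ioo_subset_Icc_self hr)
      rw [(hasDerivAt_log_gain hβ hr' a).deriv]
      exact div_neg_of_neg_of_pos
        (sub_neg.2 (strictMonoOn_gainSlope hβ hr' ht hr.2)) hr'.1
    · have hsub : Set.Icc t s ⊆ Set.Ioo 0 β := fun r hr =>
        ⟨ht.1.trans_le hr.1, hr.2.trans_lt hs.2⟩
      refine strictMonoOn_of_deriv_pos (convex_Icc t s)
        (fun r hr => (hasDerivAt_log_gain hβ (hsub hr) a).continuousAt.continuousWithinAt)
        (fun r hr => ?_) (Set.left_mem_Icc.2 hlt.le) (Set.right_mem_Icc.2 hlt.le) hlt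
      rw [interior_Icc] at hr
      have hr' := hsub (Set.Ioo_subset_Icc_self hr)
      rw [(hasDerivAt_log_gain hβ hr' a).deriv]
      exact div_pos (sub_pos.2 (strictMonoOn_gainSlope hβ ht hr' hr.1)) hr'.1
  have e (r : ℝ) (hr : r < β) : Real.log (gain β r) = Real.log (1 - r * β) - Real.log (β - r) :=
    Real.log_div (one_sub_mul_pos hβ hr).ne' (sub_pos.2 hr).ne'
  rw [e s hs.2, e t ht.2]
  simp only [hf] at key
  linarith

lemma gainSlope_mul_le_log_gain (hβ : β ∈ Set.Ioo (0 : ℝ) 1) {s t : ℝ}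
    (hs : s ∈ Set.Ioo 0 β) (ht : t ∈ Set.Ioo 0 β) :
    gainSlope β t * (Real.log s - Real.log t)
      ≤ Real.log (gain β s) - Real.log (gain β t) := by
  rcases eq_or_ne s t with rfl | hst
  · simp
  · exact (gainSlope_mul_lt_log_gain hβ hs ht hst).le

end Gain

/-- The tangent plane at `(1, 1)` to the convex function `(ξ, π) ↦ π ^ (1 + b) ξ ^ (-d)`, where
`ξ = exp u` and `π = exp p`. -/
lemma tangent_le_exp {b d : ℝ} (hd : 0 ≤ d) (hdb : d ≤ b) (u p : ℝ) :
    1 - d * (Real.exp u - 1) + (1 + b) * (Real.exp p - 1) ≤ Real.exp ((1 + b) * p - d * u) := by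
  have tangent (z : ℝ) : Real.exp p * (1 + z - p) ≤ Real.exp z := by
    have h1 : Real.exp z = Real.exp p * Real.exp (z - p) := by
      rw [← Real.exp_add]; ring_nf
    rw [h1]
    exact mul_le_mul_of_nonneg_left (by linarith [Real.add_one_le_exp (z - p)])
      (Real.exp_pos p).le
  have h1 := tangent ((1 + b) * p - d * u)
  have h2 := mul_le_mul_of_nonneg_left (tangent u) hd
  have h3 := mul_le_mul_of_nonneg_left (tangent 0) (sub_nonneg.2 hdb)
  rw [Real.exp_zero] at h3
  linarith

/-- A strict affine lower bound, in terms of `x` and `x * y ^ m`, for the product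
`h(x) h(y) ^ m` with `h(s) = s * gain β s`. -/
lemma tangent_lt_mul_gain {β : ℝ} (hβ : β ∈ Set.Ioo (0 : ℝ) 1) {m : ℕ} (hm : m ≠ 0)
    {X Y x y : ℝ} (hX : X ∈ Set.Ioo 0 β) (hY : Y ∈ Set.Ioo 0 β) (hXY : X ≤ Y)
    (hx : x ∈ Set.Ico 0 β) (hy : y ∈ Set.Ico 0 β) (hne : ¬ (x = X ∧ y = Y)) :
    X * gain β X * (Y * gain β Y) ^ m *
        (1 - (gainSlope β Y - gainSlope β X) * (x / X - 1)
          + (1 + gainSlope β Y) * (x * y ^ m / (X * Y ^ m) - 1))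
      < x * gain β x * (y * gain β y) ^ m := by
  have ha := gainSlope_pos hβ hX
  have hab := (strictMonoOn_gainSlope hβ).monotoneOn hX hY hXY
  set a := gainSlope β X
  set b := gainSlope β Y
  have hX0 := hX.1
  have hY0 := hY.1
  have gX := gain_pos hβ hX.2
  have gY := gain_pos hβ hY.2
  have gx := gain_pos hβ hx.2
  have gy := gain_pos hβ hy.2
  have hpos : 0 < X * gain β X * (Y * gain β Y) ^ m := by positivity
  by_cases h0 : x * y ^ m = 0
  · have hr : x * gain β x * (y * gain β y) ^ m = 0 := by
      rw [mul_pow, show x * gain β x * (y ^ m * gain β y ^ m)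
        = (x * y ^ m) * (gain β x * gain β y ^ m) by ring, h0, zero_mul]
    rw [hr, h0, zero_div]
    refine mul_neg_of_pos_of_neg hpos ?_
    have h1 : 0 ≤ (b - a) * (x / X) := mul_nonneg (sub_nonneg.2 hab) (div_nonneg hx.1 hX0.le)
    linarith
  have hx0 : 0 < x := hx.1.lt_of_ne' (left_ne_zero_of_mul h0)
  have hy0 : 0 < y := hy.1.lt_of_ne' fun h => h0 (by simp [h, hm])
  have hx' : x ∈ Set.Ioo 0 β := ⟨hx0, hx.2⟩
  have hy' : y ∈ Set.Ioo 0 β := ⟨hy0, hy.2⟩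
  have hmR : (0 : ℝ) < m := by positivity
  set u := Real.log x - Real.log X with hu
  set v := Real.log y - Real.log Y with hv
  have hxu : x / X = Real.exp u := by
    rw [hu, Real.exp_sub, Real.exp_log hx0, Real.exp_log hX0]
  have hyv : y / Y = Real.exp v := by
    rw [hv, Real.exp_sub, Real.exp_log hy0, Real.exp_log hY0]
  have hp : x * y ^ m / (X * Y ^ m) = Real.exp (u + m * v) := by
    rw [mul_div_mul_comm, ← div_pow, hxu, hyv, Real.exp_add, Real.exp_nat_mul]
  have hgain (s : ℝ) (t : ℝ) (hs : 0 < gain β s) (ht : 0 < gain β t) :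
      gain β s = gain β t * Real.exp (Real.log (gain β s) - Real.log (gain β t)) := by
    rw [Real.exp_sub, Real.exp_log hs, Real.exp_log ht]
    field_simp
  have hgx := hgain x X gx gX
  have hgy := hgain y Y gy gY
  set k := Real.log (gain β x) - Real.log (gain β X)
  set l := Real.log (gain β y) - Real.log (gain β Y)
  have hlt : a * u + m * (b * v) < k + m * l := by
    by_cases hxX : x = X
    · have hyY : y ≠ Y := fun h => hne ⟨hxX, h⟩
      exact add_lt_add_of_le_of_lt (gainSlope_mul_le_log_gain hβ hx' hX)
        (mul_lt_mul_of_pos_left (gainSlope_mul_lt_log_gain hβ hy' hY hyY) hmR)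
    · exact add_lt_add_of_lt_of_le (gainSlope_mul_lt_log_gain hβ hx' hX hxX)
        (mul_le_mul_of_nonneg_left (gainSlope_mul_le_log_gain hβ hy' hY) hmR.le)
  have hprod : x * gain β x * (y * gain β y) ^ m
      = X * gain β X * (Y * gain β Y) ^ m * Real.exp (u + m * v + (k + m * l)) := by
    rw [hgx, hgy, (div_eq_iff hX0.ne').1 hxu, (div_eq_iff hY0.ne').1 hyv,
      Real.exp_add, Real.exp_add, Real.exp_add, Real.exp_nat_mul, Real.exp_nat_mul]
    ring
  rw [hprod, hp, hxu]
  refine mul_lt_mul_of_pos_left ?_ hpos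
  refine (tangent_le_exp (sub_nonneg.2 hab) (by linarith) u (u + m * v)).trans_lt ?_
  refine Real.exp_lt_exp.2 ?_
  linarith

/-- Every attainable value `p = x * y ^ m` can be realised as `X * Y ^ m` with `X ≤ Y`, without
increasing `x`, and with `X = x` unless `X = Y`. -/
lemma exists_le_mul_pow_eq {β x p : ℝ} {m : ℕ} (hm : m ≠ 0) (hβ : 0 < β) (hx : x ∈ Set.Ioo 0 β)
    (hp : 0 < p) (hpx : p < x * β ^ m) :
    ∃ X Y : ℝ, X ∈ Set.Ioo 0 β ∧ Y ∈ Set.Ioo 0 β ∧ X ≤ Y ∧ X ≤ x ∧ (X = x ∨ X = Y) ∧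
      X * Y ^ m = p := by
  have hx0 := hx.1
  have root (q : ℝ) (hq : 0 < q) (n : ℕ) (hn : n ≠ 0) : ∃ r : ℝ, 0 < r ∧ r ^ n = q :=
    ⟨q ^ (n⁻¹ : ℝ), by positivity, Real.rpow_inv_natCast_pow hq.le hn⟩
  by_cases hc : x ^ (m + 1) ≤ p
  · obtain ⟨Y, hY0, hY⟩ := root (p / x) (by positivity) m hm
    refine ⟨x, Y, hx, ⟨hY0, ?_⟩, ?_, le_rfl, Or.inl rfl, ?_⟩
    · refine lt_of_pow_lt_pow_left₀ m hβ.le ?_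
      rw [hY, div_lt_iff₀ hx0]
      linarith
    · refine le_of_pow_le_pow_left₀ hm hY0.le ?_
      rw [hY, le_div_iff₀ hx0, ← pow_succ]
      exact hc
    · rw [hY]
      field_simp
  · obtain ⟨X, hX0, hX⟩ := root p hp (m + 1) m.succ_ne_zero
    have hXx : X < x := lt_of_pow_lt_pow_left₀ (m + 1) hx0.le (by rw [hX]; exact not_le.1 hc)
    have hXβ : X ∈ Set.Ioo 0 β := ⟨hX0, hXx.trans hx.2⟩
    exact ⟨X, X, hXβ, hXβ, le_rfl, hXx.le, Or.inr rfl, by rw [← hX, pow_succ']⟩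

/-- The hard optimization step: a minimizer of
`α₁ h(x₁) h(y₁)^m + α₂ h(x₂) h(y₂)^m` on `[0,β)⁴` under the constraints
`α₁ x₁ y₁^m + α₂ x₂ y₂^m = c₁` and `α₁ x₁ + α₂ x₂ ≤ c₂` must have `x₁ = x₂` and
`y₁ = y₂`, where `h(s) = s(1-sβ)/(β-s)`. -/
theorem optimization_minimizer_symmetric
    (β : ℝ) (hβ : β ∈ Set.Ioo (0 : ℝ) 1) (m : ℕ) (hm : 1 ≤ m)
    (α₁ α₂ c₁ c₂ : ℝ) (hα₁ : 0 < α₁) (hα₂ : 0 < α₂) (hc₁ : 0 < c₁) (hc₂ : 0 < c₂)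
    (h : ℝ → ℝ) (hdef : ∀ s, h s = s * (1 - s * β) / (β - s))
    (x₁ y₁ x₂ y₂ : ℝ)
    (hx₁ : x₁ ∈ Set.Ico 0 β) (hy₁ : y₁ ∈ Set.Ico 0 β)
    (hx₂ : x₂ ∈ Set.Ico 0 β) (hy₂ : y₂ ∈ Set.Ico 0 β)
    (hcon₁ : α₁ * x₁ * y₁ ^ m + α₂ * x₂ * y₂ ^ m = c₁)
    (hcon₂ : α₁ * x₁ + α₂ * x₂ ≤ c₂)
    (hmin : ∀ x₁' y₁' x₂' y₂' : ℝ,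
      x₁' ∈ Set.Ico 0 β → y₁' ∈ Set.Ico 0 β → x₂' ∈ Set.Ico 0 β → y₂' ∈ Set.Ico 0 β →
      α₁ * x₁' * y₁' ^ m + α₂ * x₂' * y₂' ^ m = c₁ →
      α₁ * x₁' + α₂ * x₂' ≤ c₂ →
      α₁ * h x₁ * h y₁ ^ m + α₂ * h x₂ * h y₂ ^ m
        ≤ α₁ * h x₁' * h y₁' ^ m + α₂ * h x₂' * h y₂' ^ m) :
    x₁ = x₂ ∧ y₁ = y₂ := by
  obtain ⟨hβ0, hβ1⟩ := hβ
  have hβ : β ∈ Set.Ioo (0 : ℝ) 1 := ⟨hβ0, hβ1⟩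
  have hm0 : m ≠ 0 := by omega
  have hh (s : ℝ) : h s = s * gain β s := by rw [hdef, gain, mul_div_assoc]
  have hA : 0 < α₁ + α₂ := by positivity
  have y₁m : y₁ ^ m < β ^ m := pow_lt_pow_left₀ hy₁.2 hy₁.1 hm0
  have y₂m : y₂ ^ m < β ^ m := pow_lt_pow_left₀ hy₂.2 hy₂.1 hm0
  have hsum : 0 < α₁ * x₁ + α₂ * x₂ := by
    refine (add_nonneg (mul_nonneg hα₁.le hx₁.1) (mul_nonneg hα₂.le hx₂.1)).lt_of_ne' fun h0 => ?_
    have e₁ : α₁ * x₁ = 0 := by nlinarith [mul_nonneg hα₁.le hx₁.1, mul_nonneg hα₂.le hx₂.1]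
    have e₂ : α₂ * x₂ = 0 := by linarith
    rw [e₁, e₂] at hcon₁
    linarith
  have hlt : c₁ < (α₁ * x₁ + α₂ * x₂) * β ^ m := by
    rcases (mul_nonneg hα₁.le hx₁.1).eq_or_lt' with e | e
    · have e' : 0 < α₂ * x₂ := by linarith
      rw [← hcon₁, e]
      nlinarith [mul_lt_mul_of_pos_left y₂m e']
    · nlinarith [mul_lt_mul_of_pos_left y₁m e,
        mul_le_mul_of_nonneg_left y₂m.le (mul_nonneg hα₂.le hx₂.1)]
  obtain ⟨X, Y, hX, hY, hXY, hXx, hor, hp⟩ :=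
    exists_le_mul_pow_eq (β := β) (x := (α₁ * x₁ + α₂ * x₂) / (α₁ + α₂)) (p := c₁ / (α₁ + α₂))
      hm0 hβ0
      ⟨by positivity, by
        rw [div_lt_iff₀ hA]
        nlinarith [mul_lt_mul_of_pos_left hx₁.2 hα₁, mul_lt_mul_of_pos_left hx₂.2 hα₂]⟩
      (by positivity)
      (by rw [div_mul_eq_mul_div]; exact div_lt_div_of_pos_right hlt hA)
  rw [le_div_iff₀ hA] at hXx
  rw [eq_div_iff hA.ne'] at hp
  have hX0 := hX.1
  have hY0 := hY.1
  have hle := hmin X Y X Y ⟨hX0.le, hX.2⟩ ⟨hY0.le, hY.2⟩ ⟨hX0.le, hX.2⟩ ⟨hY0.le, hY.2⟩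
    (by linarith) (by linarith)
  simp only [hh] at hle
  set F := X * gain β X * (Y * gain β Y) ^ m with hF
  set d := gainSlope β Y - gainSlope β X with hd
  set b := gainSlope β Y
  set T : ℝ → ℝ → ℝ := fun x y =>
    F * (1 - d * (x / X - 1) + (1 + b) * (x * y ^ m / (X * Y ^ m) - 1)) with hT
  have hbal₁ : d * (α₁ * (x₁ / X - 1) + α₂ * (x₂ / X - 1)) = 0 := by
    rcases hor with e | e
    · rw [eq_div_iff hA.ne'] at e
      have : α₁ * (x₁ / X - 1) + α₂ * (x₂ / X - 1) = 0 := by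
        field_simp
        linarith
      rw [this, mul_zero]
    · simp [hd, b, e]
  have hbal₂ : α₁ * (x₁ * y₁ ^ m / (X * Y ^ m) - 1) + α₂ * (x₂ * y₂ ^ m / (X * Y ^ m) - 1) = 0 := by
    field_simp
    linarith
  have htot : α₁ * T x₁ y₁ + α₂ * T x₂ y₂ = (α₁ + α₂) * F := by
    simp only [hT]
    linear_combination (-F) * hbal₁ + F * (1 + b) * hbal₂
  have hTlt {x y : ℝ} (hx : x ∈ Set.Ico 0 β) (hy : y ∈ Set.Ico 0 β) (hne : ¬ (x = X ∧ y = Y)) :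
      T x y < x * gain β x * (y * gain β y) ^ m :=
    tangent_lt_mul_gain hβ hm0 hX hY hXY hx hy hne
  have hTle {x y : ℝ} (hx : x ∈ Set.Ico 0 β) (hy : y ∈ Set.Ico 0 β) :
      T x y ≤ x * gain β x * (y * gain β y) ^ m := by
    by_cases hne : x = X ∧ y = Y
    · obtain ⟨rfl, rfl⟩ := hne
      have e₁ : x / x = 1 := div_self hX0.ne'
      have e₂ : x * y ^ m / (x * y ^ m) = 1 := div_self (by positivity)
      simp [hT, hF, e₁, e₂]
    · exact (hTlt hx hy hne).le
  have E₁ : x₁ = X ∧ y₁ = Y := by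
    by_contra hne
    have h1 := mul_lt_mul_of_pos_left (hTlt hx₁ hy₁ hne) hα₁
    have h2 := mul_le_mul_of_nonneg_left (hTle hx₂ hy₂) hα₂.le
    linarith
  have E₂ : x₂ = X ∧ y₂ = Y := by
    by_contra hne
    have h1 := mul_le_mul_of_nonneg_left (hTle hx₁ hy₁) hα₁.le
    have h2 := mul_lt_mul_of_pos_left (hTlt hx₂ hy₂ hne) hα₂
    linarith
  exact ⟨E₁.1.trans E₂.1.symm, E₁.2.trans E₂.2.symm⟩

end RWHitting
end
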